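/- arXiv:0910.4639 — 8 statements merged into one kernel-verified Lean document; each statement's English description precedes it below -/
import Mathlib

section
/- Every Gorenstein semisimple commutative ring is Gorenstein Von Neumann regular; that is, if every module over a commutative ring R is Gorenstein projective, then every R-module is Gorenstein flat. -/
universe u

/-- An `R`-module `M` is **Gorenstein projective** if there exists an exact complex
`P : ⋯ → P₋₁ → P₀ → P₁ → ⋯` of projective `R`-modules with `M` isomorphic to the image
of `P₀ → P₁`, such that `Hom_R(P, Q)` is exact for every projective `R`-module `Q`. -/
def IsGorensteinProjective (R : Type u) [CommRing R] (M : Type u)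
    [AddCommGroup M] [Module R M] : Prop :=
  ∃ (P : ℤ → ModuleCat.{u} R) (d : ∀ i : ℤ, P i →ₗ[R] P (i + 1)),
    (∀ i, Module.Projective R (P i)) ∧
    (∀ i, LinearMap.range (d i) = LinearMap.ker (d (i + 1))) ∧
    Nonempty (M ≃ₗ[R] LinearMap.range (d 0)) ∧
    (∀ Q : ModuleCat.{u} R, Module.Projective R Q →
      ∀ (i : ℤ) (f : P (i + 1) →ₗ[R] Q), f.comp (d i) = 0 →
        ∃ g : P (i + 1 + 1) →ₗ[R] Q, f = g.comp (d (i + 1)))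

/-- An `R`-module `M` is **Gorenstein flat** if there exists an exact complex
`F : ⋯ → F₋₁ → F₀ → F₁ → ⋯` of flat `R`-modules with `M` isomorphic to the image
of `F₀ → F₁`, such that `I ⊗_R F` is exact for every injective `R`-module `I`. -/
def IsGorensteinFlat (R : Type u) [CommRing R] (M : Type u)
    [AddCommGroup M] [Module R M] : Prop :=
  ∃ (F : ℤ → ModuleCat.{u} R) (d : ∀ i : ℤ, F i →ₗ[R] F (i + 1)),
    (∀ i, Module.Flat R (F i)) ∧
    (∀ i, LinearMap.range (d i) = LinearMap.ker (d (i + 1))) ∧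
    Nonempty (M ≃ₗ[R] LinearMap.range (d 0)) ∧
    (∀ I : ModuleCat.{u} R, Module.Injective R I →
      ∀ i : ℤ, LinearMap.range (LinearMap.lTensor (R := R) (M := I) (d i)) =
        LinearMap.ker (LinearMap.lTensor (R := R) (M := I) (d (i + 1))))

/-- An injective module that is Gorenstein projective is projective. -/
theorem IsGorensteinProjective.projective_of_injective {R : Type u} [CommRing R] {I : Type u}
    [AddCommGroup I] [Module R I] (h : IsGorensteinProjective R I) [Module.Injective R I] :
    Module.Projective R I := by
  obtain ⟨P, d, hP, -, ⟨e⟩, -⟩ := h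
  obtain ⟨r, hr⟩ := Module.Injective.out ((LinearMap.range (d 0)).subtype ∘ₗ e.toLinearMap)
    (Subtype.val_injective.comp e.injective) LinearMap.id
  have := hP (0 + 1)
  exact Module.Projective.of_split _ r (LinearMap.ext hr)

/-- Every Gorenstein semisimple commutative ring is Gorenstein Von Neumann regular:
if every `R`-module is Gorenstein projective, then every `R`-module is Gorenstein flat. -/
theorem gorensteinSemisimple_is_gorensteinVonNeumannRegular (R : Type u) [CommRing R]
    (h : ∀ (M : Type u) [AddCommGroup M] [Module R M], IsGorensteinProjective R M) :
    ∀ (M : Type u) [AddCommGroup M] [Module R M], IsGorensteinFlat R M := by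
  intro M _ _
  obtain ⟨P, d, hP, hd, hM, -⟩ := h M
  refine ⟨P, d, fun i ↦ have := hP i; inferInstance, hd, hM, fun I hI i ↦ ?_⟩
  have := (h I).projective_of_injective
  exact (Module.Flat.lTensor_exact I (LinearMap.exact_iff.mpr (hd i).symm)).linearMap_ker_eq.symm
end

section
/- For a commutative ring R, the following are equivalent: (1) every injective R-module is flat (i.e., R is an IF-ring); (2) every Gorenstein injective R-module is Gorenstein flat. -/
universe u

/-- An `R`-module `M` is **Gorenstein injective** if there exists an exact complex
`I : ⋯ → I₋₁ → I₀ → I₁ → ⋯` of injective `R`-modules with `M` isomorphic to the image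
of `I₀ → I₁`, such that `Hom_R(J, I)` is exact for every injective `R`-module `J`. -/
def IsGorensteinInjective (R : Type u) [CommRing R] (M : Type u)
    [AddCommGroup M] [Module R M] : Prop :=
  ∃ (I : ℤ → ModuleCat.{u} R) (d : ∀ i : ℤ, I i →ₗ[R] I (i + 1)),
    (∀ i, Module.Injective R (I i)) ∧
    (∀ i, LinearMap.range (d i) = LinearMap.ker (d (i + 1))) ∧
    Nonempty (M ≃ₗ[R] LinearMap.range (d 0)) ∧
    (∀ J : ModuleCat.{u} R, Module.Injective R J →
      ∀ (i : ℤ) (f : J →ₗ[R] I (i + 1)), (d (i + 1)).comp f = 0 →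
        ∃ g : J →ₗ[R] I i, f = (d i).comp g)

theorem injective_prod_self {R M : Type u} [CommRing R] [AddCommGroup M] [Module R M]
    (hM : Module.Injective R M) : Module.Injective R (M × M) := by
  refine ⟨fun X Y _ _ _ _ f hf g => ?_⟩
  obtain ⟨p, hp⟩ := hM.out f hf ((LinearMap.fst R M M).comp g)
  obtain ⟨q, hq⟩ := hM.out f hf ((LinearMap.snd R M M).comp g)
  exact ⟨p.prod q, fun x => Prod.ext (hp x) (hq x)⟩

/-- An injective module `M` is Gorenstein injective, as shown by the complex with terms `M × M`
and differentials `(a, b) ↦ (b, 0)`. -/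
theorem Module.Injective.isGorensteinInjective {R M : Type u} [CommRing R] [AddCommGroup M]
    [Module R M] (hM : Module.Injective R M) : IsGorensteinInjective R M := by
  let d : (M × M) →ₗ[R] (M × M) := (LinearMap.inl R M M).comp (LinearMap.snd R M M)
  have range_eq : LinearMap.range d = LinearMap.range (LinearMap.inl R M M) :=
    LinearMap.range_comp_of_range_eq_top _ (LinearMap.range_eq_top.2 LinearMap.snd_surjective)
  refine ⟨fun _ => ModuleCat.of R (M × M), fun _ => d, fun _ => injective_prod_self hM,
    fun _ => ?_, ⟨?_⟩, fun J _ _ f hf => ?_⟩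
  · change LinearMap.range d = LinearMap.ker d
    rw [range_eq, LinearMap.range_inl, LinearMap.ker_comp_of_ker_eq_bot]
    exact LinearMap.ker_eq_bot.2 LinearMap.inl_injective
  · exact (LinearEquiv.ofInjective (LinearMap.inl R M M) LinearMap.inl_injective).trans
      (LinearEquiv.ofEq _ _ range_eq.symm)
  · refine ⟨(LinearMap.inr R M M).comp ((LinearMap.fst R M M).comp f), ?_⟩
    ext x
    · rfl
    · exact congrArg Prod.fst (LinearMap.congr_fun hf x)

/-- An injective module embedded in a flat module is a retract of it, hence flat. -/
theorem Module.Injective.flat_of_injective_linearMap {R M N : Type u} [CommRing R]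
    [AddCommGroup M] [Module R M] [AddCommGroup N] [Module R N] [Module.Flat R N]
    (hM : Module.Injective R M) (f : M →ₗ[R] N) (hf : Function.Injective f) :
    Module.Flat R M := by
  obtain ⟨r, hr⟩ := hM.out f hf LinearMap.id
  exact Module.Flat.of_retract f r (LinearMap.ext hr)

/-- For a commutative ring `R`, every injective `R`-module is flat (`R` is an IF-ring)
iff every Gorenstein injective `R`-module is Gorenstein flat. -/
theorem ifRing_iff_gorensteinInjective_gorensteinFlat (R : Type u) [CommRing R] :
    (∀ (I : Type u) [AddCommGroup I] [Module R I], Module.Injective R I → Module.Flat R I) ↔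
    (∀ (M : Type u) [AddCommGroup M] [Module R M],
      IsGorensteinInjective R M → IsGorensteinFlat R M) := by
  constructor
  · rintro h M _ _ ⟨I, d, hI, hd, hM, -⟩
    refine ⟨I, d, fun i => h _ (hI i), hd, hM, fun J hJ i => ?_⟩
    have : Module.Flat R J := h _ hJ
    have exact_d : Function.Exact (d i) (d (i + 1)) := LinearMap.exact_iff.2 (hd i).symm
    exact (LinearMap.exact_iff.1 (Module.Flat.lTensor_exact J exact_d)).symm
  · intro h M _ _ hM
    obtain ⟨F, d, hF, -, ⟨e⟩, -⟩ := h M hM.isGorensteinInjective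
    have : Module.Flat R (F (0 + 1)) := hF _
    exact hM.flat_of_injective_linearMap ((LinearMap.range (d 0)).subtype.comp e.toLinearMap)
      ((Submodule.injective_subtype _).comp e.injective)
end

section
/- Let R be a coherent commutative ring and n ≥ 0 an integer. Then the Gorenstein weak global dimension of R is at most n if and only if every injective R-module has flat dimension at most n. -/
universe u

/-- Auxiliary: flat dimension at most `n`, phrased recursively on objects of `ModuleCat R`:
`fd ≤ 0` means flat, and `fd ≤ n+1` means there is a surjection from a flat module whose
kernel has flat dimension at most `n` (i.e. there is an exact sequence
`0 → F_n → ⋯ → F_0 → M → 0` with every `F_i` flat). -/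
def flatDimLEAux (R : Type u) [CommRing R] : ℕ → ModuleCat.{u} R → Prop
  | 0, M => Module.Flat R M
  | n + 1, M => ∃ (F : ModuleCat.{u} R) (f : F →ₗ[R] M),
      Function.Surjective f ∧ Module.Flat R F ∧
      flatDimLEAux R n (ModuleCat.of R (LinearMap.ker f))

/-- The flat dimension of the `R`-module `M` is at most `n`. -/
def FlatDimLE (R : Type u) [CommRing R] (n : ℕ) (M : Type u)
    [AddCommGroup M] [Module R M] : Prop :=
  flatDimLEAux R n (ModuleCat.of R M)

/-- Auxiliary: Gorenstein flat dimension at most `n`, phrased recursively: `Gfd ≤ 0` means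
Gorenstein flat, and `Gfd ≤ n+1` means there is a surjection from a Gorenstein flat module
whose kernel has Gorenstein flat dimension at most `n` (i.e. there is an exact sequence
`0 → G_n → ⋯ → G_0 → M → 0` with every `G_i` Gorenstein flat). -/
def gorensteinFlatDimLEAux (R : Type u) [CommRing R] : ℕ → ModuleCat.{u} R → Prop
  | 0, M => IsGorensteinFlat R M
  | n + 1, M => ∃ (G : ModuleCat.{u} R) (f : G →ₗ[R] M),
      Function.Surjective f ∧ IsGorensteinFlat R G ∧
      gorensteinFlatDimLEAux R n (ModuleCat.of R (LinearMap.ker f))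

/-- The Gorenstein flat dimension of the `R`-module `M` is at most `n`. -/
def GorensteinFlatDimLE (R : Type u) [CommRing R] (n : ℕ) (M : Type u)
    [AddCommGroup M] [Module R M] : Prop :=
  gorensteinFlatDimLEAux R n (ModuleCat.of R M)

/-- A commutative ring is **coherent** if every finitely generated ideal is finitely
presented (as an `R`-module). -/
def IsCoherentRing (R : Type u) [CommRing R] : Prop :=
  ∀ I : Ideal R, I.FG → Module.FinitePresentation R I

namespace GorensteinFlat

open Function LinearMap

variable {R : Type u} [CommRing R]

section Modules

variable {A B C K P F H Q L N G M : Type u}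
  [AddCommGroup A] [Module R A] [AddCommGroup B] [Module R B] [AddCommGroup C] [Module R C]
  [AddCommGroup K] [Module R K] [AddCommGroup P] [Module R P] [AddCommGroup F] [Module R F]
  [AddCommGroup H] [Module R H] [AddCommGroup Q] [Module R Q] [AddCommGroup L] [Module R L]
  [AddCommGroup N] [Module R N] [AddCommGroup G] [Module R G] [AddCommGroup M] [Module R M]

/-- The sequence `0 → A → B → C → 0` given by `i` and `p` is exact. -/
structure IsShortExact (i : A →ₗ[R] B) (p : B →ₗ[R] C) : Prop where
  inj : Injective i
  exact : Exact i p
  surj : Surjective p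

theorem isShortExact_ker {p : B →ₗ[R] C} (hp : Surjective p) :
    IsShortExact (ker p).subtype p :=
  ⟨Subtype.val_injective, fun y => ⟨fun h => ⟨⟨y, h⟩, rfl⟩, by rintro ⟨x, rfl⟩; exact x.2⟩, hp⟩

theorem isShortExact_range {i : A →ₗ[R] B} (hi : Injective i) :
    IsShortExact i (range i).mkQ :=
  ⟨hi, i.exact_map_mkQ_range, Submodule.mkQ_surjective _⟩

/-- The kernel term of a short exact sequence is the kernel of the surjection. -/
noncomputable def IsShortExact.equivKer {i : A →ₗ[R] B} {p : B →ₗ[R] C}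
    (h : IsShortExact i p) : A ≃ₗ[R] ker p :=
  (LinearEquiv.ofInjective i h.inj).trans
    (LinearEquiv.ofEq _ _ (exact_iff.mp h.exact).symm)

theorem IsShortExact.comp_equiv {i : A →ₗ[R] B} {p : B →ₗ[R] C} (h : IsShortExact i p)
    (e : C ≃ₗ[R] M) : IsShortExact i (e.toLinearMap ∘ₗ p) :=
  ⟨h.inj, fun y => by simpa using h.exact y, e.surjective.comp h.surj⟩

theorem exists_isShortExact_free (M : Type u) [AddCommGroup M] [Module R M] :
    ∃ (K P : ModuleCat.{u} R) (i : K →ₗ[R] P) (p : P →ₗ[R] M),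
      IsShortExact i p ∧ Module.Projective R P :=
  ⟨ModuleCat.of R (ker (Finsupp.linearCombination R (id : M → M))), ModuleCat.of R (M →₀ R), _, _,
    isShortExact_ker (Finsupp.linearCombination_id_surjective R M),
    inferInstanceAs (Module.Projective R (M →₀ R))⟩

theorem exists_isShortExact_injective (M : Type u) [AddCommGroup M] [Module R M] :
    ∃ (I C : ModuleCat.{u} R) (i : M →ₗ[R] I) (p : I →ₗ[R] C),
      IsShortExact i p ∧ Module.Injective R I := by
  obtain ⟨⟨J, hJ, f, hf⟩⟩ :=
    CategoryTheory.EnoughInjectives.presentation (ModuleCat.of R M)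
  have hJ' : CategoryTheory.Injective (ModuleCat.of R J) := hJ
  exact ⟨J, ModuleCat.of R (J ⧸ range f.hom), f.hom, _,
    isShortExact_range ((ModuleCat.mono_iff_injective f).mp hf),
    Module.injective_module_of_injective_object R J⟩

/-- `Tor₁(A, B) = 0`, phrased as: tensoring with `A` preserves exactness of every short exact
sequence ending in `B`. -/
def TorOneVanishes (R A B : Type u) [CommRing R] [AddCommGroup A] [Module R A]
    [AddCommGroup B] [Module R B] : Prop :=
  ∀ (Z F : ModuleCat.{u} R) (i : Z →ₗ[R] F) (p : F →ₗ[R] B),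
    IsShortExact i p → Injective (lTensor A i)

theorem lTensor_rTensor_apply (f : A →ₗ[R] B) (g : M →ₗ[R] N) (x : TensorProduct R A M) :
    lTensor B g (rTensor M f x) = rTensor N f (lTensor A g x) :=
  LinearMap.congr_fun ((lTensor_comp_rTensor _ f g).trans (rTensor_comp_lTensor _ f g).symm) x

theorem lTensor_injective_of_rTensor_injective [Module.Flat R Q]
    {j : K →ₗ[R] Q} {q : Q →ₗ[R] A} (hA : IsShortExact j q)
    {i : N →ₗ[R] F} {p : F →ₗ[R] B} (hB : IsShortExact i p)
    (h : Injective (rTensor B j)) : Injective (lTensor A i) := by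
  rw [injective_iff_map_eq_zero]
  intro x hx
  obtain ⟨y, rfl⟩ := rTensor_surjective N hA.surj x
  rw [lTensor_rTensor_apply] at hx
  obtain ⟨k, hk⟩ := (rTensor_exact F hA.exact hA.surj _).mp hx
  have hk0 : lTensor K p k = 0 := by
    apply (injective_iff_map_eq_zero _).mp h
    rw [← lTensor_rTensor_apply, hk]
    exact (lTensor_exact Q hB.exact hB.surj _).mpr ⟨y, rfl⟩
  obtain ⟨k', rfl⟩ := (lTensor_exact K hB.exact hB.surj _).mp hk0
  have : y = rTensor N j k' := by
    apply Module.Flat.lTensor_preserves_injective_linearMap (M := Q) i hB.inj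
    rw [lTensor_rTensor_apply, hk]
  rw [this]
  exact (rTensor_exact N hA.exact hA.surj _).mpr ⟨k', rfl⟩

theorem torOneVanishes_of_lTensor_injective [Module.Flat R F]
    {i : N →ₗ[R] F} {p : F →ₗ[R] B} (hB : IsShortExact i p)
    (h : Injective (lTensor A i)) : TorOneVanishes R A B := by
  intro Z F' i' p' hB'
  obtain ⟨K, Q, j, q, hA, hQ⟩ := exists_isShortExact_free (R := R) A
  refine lTensor_injective_of_rTensor_injective hA hB' ?_
  rw [← lTensor_inj_iff_rTensor_inj]
  refine lTensor_injective_of_rTensor_injective hB hA ?_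
  rwa [← lTensor_inj_iff_rTensor_inj]

theorem TorOneVanishes.lTensor_injective (h : TorOneVanishes R A B)
    {i : N →ₗ[R] F} {p : F →ₗ[R] B} (hB : IsShortExact i p) : Injective (lTensor A i) :=
  h (ModuleCat.of R N) (ModuleCat.of R F) i p hB

theorem TorOneVanishes.symm (h : TorOneVanishes R A B) : TorOneVanishes R B A := by
  intro K Q j q hA
  obtain ⟨Z, F, i, p, hB, hF⟩ := exists_isShortExact_free (R := R) B
  refine lTensor_injective_of_rTensor_injective hB hA ?_
  rw [← lTensor_inj_iff_rTensor_inj]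
  exact h.lTensor_injective hB

theorem TorOneVanishes.rTensor_injective (h : TorOneVanishes R A B)
    {j : K →ₗ[R] Q} {q : Q →ₗ[R] A} (hA : IsShortExact j q) : Injective (rTensor B j) := by
  rw [← lTensor_inj_iff_rTensor_inj]
  exact h.symm.lTensor_injective hA

theorem TorOneVanishes.congr_right (h : TorOneVanishes R A B) (e : C ≃ₗ[R] B) :
    TorOneVanishes R A C :=
  fun _ _ _ _ hC => h.lTensor_injective (hC.comp_equiv e)

variable (A B) in
theorem torOneVanishes_of_flat_left [Module.Flat R A] : TorOneVanishes R A B :=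
  fun _ _ i _ hB => Module.Flat.lTensor_preserves_injective_linearMap i hB.inj

variable (A B) in
theorem torOneVanishes_of_flat_right [Module.Flat R B] : TorOneVanishes R A B :=
  (torOneVanishes_of_flat_left B A).symm

theorem flat_of_torOneVanishes
    (h : ∀ (B : Type u) [AddCommGroup B] [Module R B], TorOneVanishes R A B) :
    Module.Flat R A :=
  Module.Flat.iff_lTensor_preserves_injective_linearMap.mpr
    fun _ _ _ _ _ _ _ hf => (h _).lTensor_injective (isShortExact_range hf)

/-- Dimension shifting: `Tor₂(H', M) = Tor₁(H, M)` vanishes when `Tor₁(H', N)` and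
`Tor₂(H', G) = Tor₁(H, G)` vanish. -/
theorem TorOneVanishes.shift [Module.Flat R Q] {j : H →ₗ[R] Q} {q : Q →ₗ[R] A}
    (hA : IsShortExact j q) {i : N →ₗ[R] G} {p : G →ₗ[R] M} (hM : IsShortExact i p)
    (hN : TorOneVanishes R A N) (hG : TorOneVanishes R H G) : TorOneVanishes R H M := by
  have hinj : Injective (lTensor H i) := by
    refine Injective.of_comp (f := rTensor G j) ?_
    rw [← coe_comp, rTensor_comp_lTensor, ← lTensor_comp_rTensor, coe_comp]
    exact (Module.Flat.lTensor_preserves_injective_linearMap i hM.inj).comp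
      (hN.rTensor_injective hA)
  obtain ⟨Ω, P, a, g, hP, hP'⟩ := exists_isShortExact_free (R := R) G
  have hsurj : Surjective (p ∘ₗ g) := hM.surj.comp hP.surj
  refine torOneVanishes_of_lTensor_injective (isShortExact_ker hsurj) ?_
  have hmem : ∀ x : ker (p ∘ₗ g), ∃ n, i n = g x := fun x => (hM.exact _).mp x.2
  let e := LinearEquiv.ofInjective i hM.inj
  let b : ker (p ∘ₗ g) →ₗ[R] N := e.symm.toLinearMap ∘ₗ
    (g ∘ₗ (ker (p ∘ₗ g)).subtype).codRestrict (range i) hmem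
  have hb : ∀ x, i (b x) = g x := fun x =>
    congrArg Subtype.val (e.apply_symm_apply ⟨g x, hmem x⟩)
  have hib : i ∘ₗ b = g ∘ₗ (ker (p ∘ₗ g)).subtype := LinearMap.ext hb
  let a' : Ω →ₗ[R] ker (p ∘ₗ g) := a.codRestrict _ fun x => by
    simp [hP.exact.apply_apply_eq_zero]
  have ha' : (ker (p ∘ₗ g)).subtype ∘ₗ a' = a := rfl
  have hex : Exact a' b := by
    intro x
    rw [← map_eq_zero_iff i hM.inj, hb, hP.exact x]
    exact ⟨fun ⟨y, hy⟩ => ⟨y, Subtype.ext hy⟩, fun ⟨y, hy⟩ => ⟨y, congrArg Subtype.val hy⟩⟩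
  have hbs : Surjective b := by
    intro n
    obtain ⟨x, hx⟩ := hP.surj (i n)
    refine ⟨⟨x, ?_⟩, hM.inj ?_⟩
    · simp [hx, hM.exact.apply_apply_eq_zero]
    · rw [hb, hx]
  rw [injective_iff_map_eq_zero]
  intro x hx
  have hbx : lTensor H b x = 0 := by
    apply (injective_iff_map_eq_zero _).mp hinj
    rw [← lTensor_comp_apply, hib, lTensor_comp_apply, hx, map_zero]
  obtain ⟨w, rfl⟩ := (lTensor_exact H hex hbs _).mp hbx
  rw [← lTensor_comp_apply, ha'] at hx
  rw [(injective_iff_map_eq_zero _).mp (hG.lTensor_injective hP) _ hx, map_zero]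

theorem TorOneVanishes.unshift [Module.Flat R Q] {j : H →ₗ[R] Q} {q : Q →ₗ[R] A}
    (hA : IsShortExact j q) [Module.Flat R F] {i : N →ₗ[R] F} {p : F →ₗ[R] M}
    (hM : IsShortExact i p) (h : TorOneVanishes R H M) : TorOneVanishes R A N :=
  (TorOneVanishes.shift hM hA h.symm (torOneVanishes_of_flat_right N Q)).symm

theorem flat_of_isShortExact {i : K →ₗ[R] P} {p : P →ₗ[R] F} (h : IsShortExact i p)
    [Module.Flat R P] [Module.Flat R F] : Module.Flat R K := by
  refine flat_of_torOneVanishes fun B _ _ Z E j q hB => ?_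
  refine Injective.of_comp (f := rTensor E i) ?_
  rw [← coe_comp, rTensor_comp_lTensor, ← lTensor_comp_rTensor, coe_comp]
  exact (Module.Flat.lTensor_preserves_injective_linearMap j hB.inj).comp
    ((torOneVanishes_of_flat_left F Z).rTensor_injective h)

theorem flat_of_isShortExact_middle {a : A →ₗ[R] B} {b : B →ₗ[R] C} (h : IsShortExact a b)
    [Module.Flat R A] [Module.Flat R C] : Module.Flat R B := by
  refine flat_of_torOneVanishes fun M _ _ N G i p hM => ?_
  rw [injective_iff_map_eq_zero]
  intro x hx
  have hbx : rTensor N b x = 0 := by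
    apply (injective_iff_map_eq_zero _).mp
      (Module.Flat.lTensor_preserves_injective_linearMap (M := C) i hM.inj)
    rw [lTensor_rTensor_apply, hx, map_zero]
  obtain ⟨y, rfl⟩ := (rTensor_exact N h.exact h.surj _).mp hbx
  rw [lTensor_rTensor_apply] at hx
  have hy := (injective_iff_map_eq_zero _).mp
    ((torOneVanishes_of_flat_left C G).rTensor_injective h) _ hx
  rw [(injective_iff_map_eq_zero _).mp
    (Module.Flat.lTensor_preserves_injective_linearMap (M := A) i hM.inj) _ hy, map_zero]

theorem flat_prod [Module.Flat R L] [Module.Flat R P] : Module.Flat R (L × P) :=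
  flat_of_isShortExact_middle (a := inl R L P) (b := snd R L P)
    ⟨inl_injective, exact_iff.mpr (ker_snd R L P), snd_surjective⟩

theorem exists_horseshoe {j : A →ₗ[R] B} {q : B →ₗ[R] C} (h : IsShortExact j q)
    {i : K →ₗ[R] P} {p : P →ₗ[R] A} (hA : IsShortExact i p) [Module.Projective R P] :
    ∃ (KB PB KC PC : ModuleCat.{u} R) (iB : KB →ₗ[R] PB) (pB : PB →ₗ[R] B)
      (iC : KC →ₗ[R] PC) (pC : PC →ₗ[R] C) (a : K →ₗ[R] KB) (b : KB →ₗ[R] KC),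
      IsShortExact iB pB ∧ Module.Projective R PB ∧ IsShortExact iC pC ∧
        Module.Projective R PC ∧ IsShortExact a b := by
  obtain ⟨KC, PC, iC, pC, hC, hPC⟩ := exists_isShortExact_free (R := R) C
  obtain ⟨s, hs⟩ := Module.projective_lifting_property q pC h.surj
  have hs' : ∀ x, q (s x) = pC x := fun x => LinearMap.congr_fun hs x
  let f : P × PC →ₗ[R] B := (j ∘ₗ p).coprod s
  have hf : ∀ x y, f (x, y) = j (p x) + s y := fun x y => by simp [f]
  have hqj : ∀ x, q (j x) = 0 := h.exact.apply_apply_eq_zero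
  have hfs : Surjective f := by
    intro y
    obtain ⟨z, hz⟩ := hC.surj (q y)
    obtain ⟨a, ha⟩ := (h.exact (y - s z)).mp (by rw [map_sub, hs', hz, sub_self])
    obtain ⟨x, rfl⟩ := hA.surj a
    exact ⟨(x, z), by rw [hf, ha, sub_add_cancel]⟩
  let a : K →ₗ[R] ker f := (inl R P PC ∘ₗ i).codRestrict _ fun x => by
    simp [hf, hA.exact.apply_apply_eq_zero]
  let b : ker f →ₗ[R] ker pC := (snd R P PC ∘ₗ (ker f).subtype).codRestrict _ fun x => by
    have := congrArg q (show j (p x.1.1) + s x.1.2 = 0 from (hf _ _).symm.trans x.2)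
    simpa [hqj, hs'] using this
  refine ⟨ModuleCat.of R (ker f), ModuleCat.of R (P × PC), ModuleCat.of R (ker pC), PC,
    _, f, _, pC, a, b, isShortExact_ker hfs, inferInstanceAs (Module.Projective R (P × PC)),
    isShortExact_ker hC.surj, hPC, ?_, ?_, ?_⟩
  · intro x y hxy
    exact hA.inj (congrArg (fun z : ker f => z.1.1) hxy)
  · rintro ⟨⟨x, y⟩, hxy⟩
    constructor
    · intro hy
      obtain rfl : y = 0 := congrArg Subtype.val hy
      have hx : p x = 0 := h.inj (by simpa [hf] using hxy)
      obtain ⟨k, rfl⟩ := (hA.exact x).mp hx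
      exact ⟨k, rfl⟩
    · rintro ⟨k, hk⟩
      have : (0 : PC) = y := congrArg (fun z : ker f => z.1.2) hk
      exact Subtype.ext this.symm
  · rintro ⟨y, hy⟩
    obtain ⟨a, ha⟩ := (h.exact (s y)).mp (by rw [hs']; exact hy)
    obtain ⟨x, rfl⟩ := hA.surj a
    exact ⟨⟨(-x, y), by simp [hf, ha]⟩, rfl⟩

theorem isShortExact_schanuel {i : K →ₗ[R] P} {p : P →ₗ[R] M} (h : IsShortExact i p)
    {f : F →ₗ[R] M} {s : P →ₗ[R] F} (hs : f ∘ₗ s = p) :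
    ∃ j : K →ₗ[R] ker f × P, IsShortExact j ((ker f).subtype.coprod s) := by
  have hs' : ∀ x, f (s x) = p x := fun x => LinearMap.congr_fun hs x
  let t : K →ₗ[R] ker f := (-(s ∘ₗ i)).codRestrict _ fun x => by
    simp [hs', h.exact.apply_apply_eq_zero]
  refine ⟨t.prod i, fun x y hxy => h.inj (congrArg Prod.snd hxy), ?_, ?_⟩
  · rintro ⟨l, x⟩
    rw [coprod_apply]
    constructor
    · intro hlx
      have hx : p x = 0 := by
        have := congrArg f hlx
        simpa [hs'] using this
      obtain ⟨k, rfl⟩ := (h.exact x).mp hx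
      exact ⟨k, Prod.ext (Subtype.ext (eq_neg_of_add_eq_zero_left hlx).symm) rfl⟩
    · rintro ⟨k, hk⟩
      obtain ⟨rfl, rfl⟩ := Prod.ext_iff.mp hk
      exact neg_add_cancel (s (i k))
  · intro y
    obtain ⟨x, hx⟩ := h.surj (f y)
    exact ⟨(⟨y - s x, by simp [hs', hx]⟩, x), by simp⟩

end Modules

section Dimension

theorem flatDimLEAux_congr {n : ℕ} : ∀ {M N : ModuleCat.{u} R}, (M ≃ₗ[R] N) →
    flatDimLEAux R n M → flatDimLEAux R n N := by
  cases n with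
  | zero => exact fun e h => (Module.Flat.equiv_iff e).mp h
  | succ n =>
    rintro M N e ⟨F, f, hf, hF, h⟩
    refine ⟨F, e.toLinearMap ∘ₗ f, e.surjective.comp hf, hF, ?_⟩
    rwa [LinearEquiv.ker_comp]

theorem isGorensteinFlat_congr {M N : Type u} [AddCommGroup M] [Module R M]
    [AddCommGroup N] [Module R N] (e : M ≃ₗ[R] N) (h : IsGorensteinFlat R M) :
    IsGorensteinFlat R N := by
  obtain ⟨F, d, hF, hd, ⟨e'⟩, hI⟩ := h
  exact ⟨F, d, hF, hd, ⟨e.symm.trans e'⟩, hI⟩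

theorem gorensteinFlatDimLEAux_congr {n : ℕ} {M N : ModuleCat.{u} R} (e : M ≃ₗ[R] N)
    (h : gorensteinFlatDimLEAux R n M) : gorensteinFlatDimLEAux R n N := by
  cases n with
  | zero => exact isGorensteinFlat_congr e h
  | succ n =>
    obtain ⟨F, f, hf, hF, h⟩ := h
    refine ⟨F, e.toLinearMap ∘ₗ f, e.surjective.comp hf, hF, ?_⟩
    rwa [LinearEquiv.ker_comp]

/-- `IsSyzygy M k K` means that `K` is the `k`-th syzygy of `M` in some projective resolution. -/
inductive IsSyzygy (M : ModuleCat.{u} R) : ℕ → ModuleCat.{u} R → Prop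
  | zero : IsSyzygy M 0 M
  | succ {k : ℕ} {H K P : ModuleCat.{u} R} (i : K →ₗ[R] P) (p : P →ₗ[R] H)
      (h : IsShortExact i p) (hP : Module.Projective R P) (hH : IsSyzygy M k H) :
      IsSyzygy M (k + 1) K

theorem exists_isSyzygy (M : ModuleCat.{u} R) (k : ℕ) : ∃ K, IsSyzygy M k K := by
  induction k with
  | zero => exact ⟨M, .zero⟩
  | succ k ih =>
    obtain ⟨H, hH⟩ := ih
    obtain ⟨K, P, i, p, h, hP⟩ := exists_isShortExact_free (R := R) H
    exact ⟨K, .succ i p h hP hH⟩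

theorem IsSyzygy.exists_of_succ {M K : ModuleCat.{u} R} {k : ℕ} (h : IsSyzygy M (k + 1) K) :
    ∃ M' : ModuleCat.{u} R, IsSyzygy M' k K := by
  induction k generalizing K with
  | zero => exact ⟨K, .zero⟩
  | succ k ih =>
    obtain _ | ⟨i, p, h, hP, hH⟩ := h
    obtain ⟨M', hM'⟩ := ih hH
    exact ⟨M', .succ i p h hP hM'⟩

theorem IsSyzygy.horseshoe {A B C : ModuleCat.{u} R} {j : A →ₗ[R] B} {q : B →ₗ[R] C}
    (h : IsShortExact j q) {k : ℕ} {K : ModuleCat.{u} R} (hK : IsSyzygy A k K) :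
    ∃ (H L : ModuleCat.{u} R) (a : K →ₗ[R] H) (b : H →ₗ[R] L),
      IsShortExact a b ∧ IsSyzygy B k H ∧ IsSyzygy C k L := by
  induction hK with
  | zero => exact ⟨B, C, j, q, h, .zero, .zero⟩
  | succ i p hip hP _ ih =>
    obtain ⟨H, L, a, b, hab, hH, hL⟩ := ih
    obtain ⟨KB, PB, KC, PC, iB, pB, iC, pC, a', b', hB, hPB, hC, hPC, hab'⟩ :=
      exists_horseshoe hab hip
    exact ⟨KB, KC, a', b', hab', .succ iB pB hB hPB hH, .succ iC pC hC hPC hL⟩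

theorem IsSyzygy.flatDimLEAux_of_syzygy {M K : ModuleCat.{u} R} {k n : ℕ} (h : IsSyzygy M k K)
    (hK : flatDimLEAux R n K) : flatDimLEAux R (n + k) M := by
  induction h generalizing n with
  | zero => exact hK
  | succ i p h hP _ ih =>
    rw [← Nat.succ_add_eq_add_succ]
    exact ih ⟨_, p, h.surj, .of_projective, flatDimLEAux_congr h.equivKer hK⟩

theorem IsSyzygy.gorensteinFlatDimLEAux_of_syzygy
    (hflat : ∀ P : ModuleCat.{u} R, Module.Flat R P → IsGorensteinFlat R P)
    {M K : ModuleCat.{u} R} {k n : ℕ} (h : IsSyzygy M k K)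
    (hK : gorensteinFlatDimLEAux R n K) : gorensteinFlatDimLEAux R (n + k) M := by
  induction h generalizing n with
  | zero => exact hK
  | succ i p h hP _ ih =>
    rw [← Nat.succ_add_eq_add_succ]
    exact ih ⟨_, p, h.surj, hflat _ .of_projective, gorensteinFlatDimLEAux_congr h.equivKer hK⟩

theorem flatDimLEAux_of_isShortExact {n : ℕ} {K E F : ModuleCat.{u} R} {i : K →ₗ[R] E}
    {p : E →ₗ[R] F} (h : IsShortExact i p) [Module.Flat R F] (hE : flatDimLEAux R n E) :
    flatDimLEAux R n K := by
  cases n with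
  | zero =>
    have : Module.Flat R E := hE
    exact flat_of_isShortExact h
  | succ n =>
    obtain ⟨Q, f, hf, hQ, hn⟩ := hE
    have hex : ∀ x : ker (p ∘ₗ f), ∃ y, i y = f x := fun x => (h.exact _).mp x.2
    let e := LinearEquiv.ofInjective i h.inj
    let g : ker (p ∘ₗ f) →ₗ[R] K := e.symm.toLinearMap ∘ₗ
      (f ∘ₗ (ker (p ∘ₗ f)).subtype).codRestrict (range i) hex
    have hg : ∀ x, i (g x) = f x := fun x =>
      congrArg Subtype.val (e.apply_symm_apply ⟨f x, hex x⟩)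
    have hgs : Surjective g := by
      intro y
      obtain ⟨x, hx⟩ := hf (i y)
      refine ⟨⟨x, ?_⟩, h.inj ?_⟩
      · simp [hx, h.exact.apply_apply_eq_zero]
      · rw [hg, hx]
    refine ⟨ModuleCat.of R (ker (p ∘ₗ f)), g, hgs,
      flat_of_isShortExact (isShortExact_ker (p := p ∘ₗ f) (h.surj.comp hf)), ?_⟩
    let t : ker f →ₗ[R] ker (p ∘ₗ f) := Submodule.inclusion (ker_le_ker_comp f p)
    refine flatDimLEAux_congr (IsShortExact.equivKer (i := t) (p := g)
      ⟨Submodule.inclusion_injective _, fun x => ?_, hgs⟩) hn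
    rw [← map_eq_zero_iff i h.inj, hg]
    exact ⟨fun hx => ⟨⟨x, hx⟩, rfl⟩, by rintro ⟨y, rfl⟩; exact y.2⟩

theorem flatDimLEAux_prod {n : ℕ} {L P : ModuleCat.{u} R} [Module.Flat R P]
    (hL : flatDimLEAux R n L) : flatDimLEAux R n (ModuleCat.of R (L × P)) := by
  cases n with
  | zero =>
    have : Module.Flat R L := hL
    exact flat_prod (L := L) (P := P)
  | succ n =>
    obtain ⟨Q, f, hf, hQ, hn⟩ := hL
    refine ⟨ModuleCat.of R (Q × P), f.prodMap LinearMap.id, hf.prodMap surjective_id,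
      flat_prod (L := Q) (P := P), ?_⟩
    let t : ker f →ₗ[R] Q × P := inl R Q P ∘ₗ (ker f).subtype
    refine flatDimLEAux_congr (IsShortExact.equivKer (i := t) (p := f.prodMap LinearMap.id)
      ⟨inl_injective.comp Subtype.val_injective, ?_, hf.prodMap surjective_id⟩) hn
    rintro ⟨x, y⟩
    constructor
    · intro hxy
      obtain ⟨hx, hy⟩ := Prod.ext_iff.mp hxy
      exact ⟨⟨x, hx⟩, Prod.ext rfl hy.symm⟩
    · rintro ⟨z, hz⟩
      obtain ⟨rfl, rfl⟩ := Prod.ext_iff.mp hz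
      exact Prod.ext z.2 rfl

theorem flatDimLEAux_syzygy {n : ℕ} {M K P : ModuleCat.{u} R} {i : K →ₗ[R] P} {p : P →ₗ[R] M}
    (h : IsShortExact i p) [Module.Projective R P] (hM : flatDimLEAux R (n + 1) M) :
    flatDimLEAux R n K := by
  obtain ⟨F, f, hf, hF, hn⟩ := hM
  obtain ⟨s, hs⟩ := Module.projective_lifting_property f p hf
  obtain ⟨j, hj⟩ := isShortExact_schanuel h hs
  exact flatDimLEAux_of_isShortExact (E := ModuleCat.of R (ker f × P)) hj
    (flatDimLEAux_prod (L := ModuleCat.of R (ker f)) hn)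

theorem IsSyzygy.flatDimLEAux {M K : ModuleCat.{u} R} {k n : ℕ} (h : IsSyzygy M k K)
    (hM : flatDimLEAux R (n + k) M) : flatDimLEAux R n K := by
  induction h generalizing n with
  | zero => exact hM
  | succ i p h hP _ ih =>
    rw [← Nat.succ_add_eq_add_succ] at hM
    exact flatDimLEAux_syzygy h (ih hM)

end Dimension

section TotallyAcyclic

theorem IsSyzygy.torOneVanishes_range {I H : ModuleCat.{u} R} {k : ℕ} (h : IsSyzygy I k H)
    {F : ℤ → ModuleCat.{u} R} {d : ∀ i : ℤ, F i →ₗ[R] F (i + 1)}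
    (hF : ∀ i, Module.Flat R (F i)) (hd : ∀ i, range (d i) = ker (d (i + 1)))
    (hI : ∀ i : ℤ, range (lTensor I (d i)) = ker (lTensor I (d (i + 1)))) (j : ℤ) :
    TorOneVanishes R H (range (d j)) := by
  have hses : ∀ i, IsShortExact (range (d i)).subtype (d (i + 1)).rangeRestrict := fun i =>
    ⟨Subtype.val_injective, exact_iff.mpr (by simp [hd]), surjective_rangeRestrict _⟩
  induction h generalizing j with
  | zero =>
    obtain ⟨i, rfl⟩ : ∃ i, j = i + 1 + 1 := ⟨j - 1 - 1, by ring⟩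
    refine torOneVanishes_of_lTensor_injective (hses (i + 1)) ?_
    rw [injective_iff_map_eq_zero]
    intro x hx
    obtain ⟨y, rfl⟩ := lTensor_surjective I (surjective_rangeRestrict (d (i + 1))) x
    have hcomp : (range (d (i + 1))).subtype ∘ₗ (d (i + 1)).rangeRestrict = d (i + 1) := rfl
    rw [← lTensor_comp_apply, hcomp, ← mem_ker, ← hI] at hx
    obtain ⟨w, rfl⟩ := hx
    have : (d (i + 1)).rangeRestrict ∘ₗ d i = 0 := by
      ext z
      exact (hd i).le ⟨z, rfl⟩
    rw [← lTensor_comp_apply, this, lTensor_zero, LinearMap.zero_apply]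
  | succ a b h hP _ ih =>
    obtain ⟨i, rfl⟩ : ∃ i, j = i + 1 := ⟨j - 1, by ring⟩
    exact (ih i).shift h (hses i) (torOneVanishes_of_flat_right _ _)

theorem IsSyzygy.torOneVanishes {I H M : ModuleCat.{u} R} (hI : Module.Injective R I) {n : ℕ}
    (hM : gorensteinFlatDimLEAux R n M) (h : IsSyzygy I n H) : TorOneVanishes R H M := by
  have key : ∀ {k : ℕ} {H G : ModuleCat.{u} R}, IsSyzygy I k H → IsGorensteinFlat R G →
      TorOneVanishes R H G := by
    rintro k H G hH ⟨F, d, hF, hd, ⟨e⟩, hT⟩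
    exact (hH.torOneVanishes_range hF hd (hT I hI) 0).congr_right e
  induction n generalizing H M with
  | zero => exact key h hM
  | succ n ih =>
    obtain ⟨G, f, hf, hG, hn⟩ := hM
    have hH := key h hG
    obtain _ | ⟨i, p, hip, hP, h'⟩ := h
    exact (ih hn h').shift hip (isShortExact_ker hf) hH

theorem torOneVanishes_of_flatDimLEAux {n : ℕ} {I : ModuleCat.{u} R} (hI : flatDimLEAux R n I)
    {Z F : ℤ → ModuleCat.{u} R} {ι : ∀ i, Z i →ₗ[R] F i} {π : ∀ i, F i →ₗ[R] Z (i + 1)}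
    (hF : ∀ i, Module.Flat R (F i)) (h : ∀ i, IsShortExact (ι i) (π i)) (i : ℤ) :
    TorOneVanishes R I (Z i) := by
  induction n generalizing I i with
  | zero =>
    have : Module.Flat R I := hI
    exact torOneVanishes_of_flat_left _ _
  | succ n ih =>
    obtain ⟨Q, f, hf, hQ, hn⟩ := hI
    exact (ih hn (i + 1)).unshift (isShortExact_ker hf) (h i)

theorem isGorensteinFlat_of_isShortExact
    {n : ℕ} (hR : ∀ I : ModuleCat.{u} R, Module.Injective R I → flatDimLEAux R n I)
    {Z F : ℤ → ModuleCat.{u} R} {ι : ∀ i, Z i →ₗ[R] F i} {π : ∀ i, F i →ₗ[R] Z (i + 1)}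
    (hF : ∀ i, Module.Flat R (F i)) (h : ∀ i, IsShortExact (ι i) (π i)) :
    IsGorensteinFlat R (Z 1) := by
  refine ⟨F, fun i => ι (i + 1) ∘ₗ π i, hF, fun i => ?_, ?_, fun I hI i => ?_⟩
  · rw [range_comp_of_range_eq_top _ (range_eq_top.mpr (h i).surj),
      ker_comp_of_ker_eq_bot _ (ker_eq_bot.mpr (h (i + 1 + 1)).inj),
      exact_iff.mp (h (i + 1)).exact]
  · rw [range_comp_of_range_eq_top _ (range_eq_top.mpr (h 0).surj)]
    exact ⟨LinearEquiv.ofInjective _ (h 1).inj⟩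
  · have hinj : Injective (lTensor I (ι (i + 1 + 1))) :=
      (torOneVanishes_of_flatDimLEAux (hR I hI) hF h _).lTensor_injective (h (i + 1 + 1))
    rw [lTensor_comp, lTensor_comp,
      range_comp_of_range_eq_top _ (range_eq_top.mpr (lTensor_surjective I (h i).surj)),
      ker_comp_of_ker_eq_bot _ (ker_eq_bot.mpr hinj),
      exact_iff.mp (lTensor_exact I (h (i + 1)).exact (h (i + 1)).surj)]

theorem exists_int_sequence {α : Type*} {r : α → α → Prop} (hs : ∀ x, ∃ y, r x y)
    (hp : ∀ y, ∃ x, r x y) (x : α) : ∃ z : ℤ → α, z 1 = x ∧ ∀ i, r (z i) (z (i + 1)) := by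
  choose s hs using hs
  choose p hp using hp
  let z : ℤ → α
    | .ofNat k => s^[k] x
    | .negSucc k => p^[k + 1] x
  have hz : ∀ i, r (z i) (z (i + 1)) := by
    rintro (k | _ | k)
    · change r (s^[k] x) (s^[k + 1] x)
      rw [iterate_succ_apply']
      exact hs _
    · exact hp _
    · change r (p^[k + 1 + 1] x) (p^[k + 1] x)
      rw [iterate_succ_apply' p (k + 1)]
      exact hp _
  refine ⟨fun i => z (i - 1), rfl, fun i => ?_⟩
  have := hz (i - 1)
  rwa [sub_add_eq_add_sub] at this

/-- A class of modules in which every member is both the kernel and the cokernel term of a short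
exact sequence with flat middle term consists of Gorenstein flat modules, provided that injective
modules have bounded flat dimension. -/
theorem isGorensteinFlat_of_class
    {n : ℕ} (hR : ∀ I : ModuleCat.{u} R, Module.Injective R I → flatDimLEAux R n I)
    {𝒞 : ModuleCat.{u} R → Prop}
    (hs : ∀ Z, 𝒞 Z → ∃ (Z' F : ModuleCat.{u} R) (ι : Z →ₗ[R] F) (π : F →ₗ[R] Z'),
      𝒞 Z' ∧ Module.Flat R F ∧ IsShortExact ι π)
    (hp : ∀ Z', 𝒞 Z' → ∃ (Z F : ModuleCat.{u} R) (ι : Z →ₗ[R] F) (π : F →ₗ[R] Z'),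
      𝒞 Z ∧ Module.Flat R F ∧ IsShortExact ι π)
    {G : ModuleCat.{u} R} (hG : 𝒞 G) : IsGorensteinFlat R G := by
  let r : Subtype 𝒞 → Subtype 𝒞 → Prop := fun Z Z' =>
    ∃ (F : ModuleCat.{u} R) (ι : Z.1 →ₗ[R] F) (π : F →ₗ[R] Z'.1),
      Module.Flat R F ∧ IsShortExact ι π
  obtain ⟨z, hz, hr⟩ := exists_int_sequence (r := r)
    (fun Z => by
      obtain ⟨Z', F, ι, π, hZ', h⟩ := hs Z.1 Z.2
      exact ⟨⟨Z', hZ'⟩, F, ι, π, h⟩)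
    (fun Z' => by
      obtain ⟨Z, F, ι, π, hZ, h⟩ := hp Z'.1 Z'.2
      exact ⟨⟨Z, hZ⟩, F, ι, π, h⟩) ⟨G, hG⟩
  choose F ι π hF h using hr
  have hG' : IsGorensteinFlat R (z 1).1 :=
    isGorensteinFlat_of_isShortExact hR (Z := fun i => (z i).1) hF h
  rwa [hz] at hG'

theorem isGorensteinFlat_of_flat_or_isSyzygy
    {n : ℕ} (hR : ∀ I : ModuleCat.{u} R, Module.Injective R I → flatDimLEAux R n I)
    {G : ModuleCat.{u} R} (hG : Module.Flat R G ∨ ∃ M : ModuleCat.{u} R, IsSyzygy M n G) :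
    IsGorensteinFlat R G := by
  refine isGorensteinFlat_of_class hR
    (𝒞 := fun G => Module.Flat R G ∨ ∃ M : ModuleCat.{u} R, IsSyzygy M n G) ?_ ?_ hG
  · rintro Z (hZ | ⟨M, hM⟩)
    · exact ⟨ModuleCat.of R PUnit, Z, LinearMap.id, 0, .inl inferInstance, hZ, injective_id,
        fun x => ⟨fun _ => ⟨x, rfl⟩, fun _ => rfl⟩, fun x => ⟨0, rfl⟩⟩
    · obtain ⟨I, C, i, p, h, hI⟩ := exists_isShortExact_injective (R := R) M
      obtain ⟨H, L, a, b, hab, hH, hL⟩ := hM.horseshoe h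
      exact ⟨L, H, a, b, .inr ⟨C, hL⟩, hH.flatDimLEAux (n := 0) (by simpa using hR I hI), hab⟩
  · rintro Z (hZ | ⟨M, hM⟩)
    · exact ⟨ModuleCat.of R PUnit, Z, 0, LinearMap.id, .inl inferInstance, hZ,
        injective_of_subsingleton _,
        fun x => ⟨fun hx => ⟨0, hx.symm⟩, by rintro ⟨_, rfl⟩; rfl⟩, surjective_id⟩
    · obtain ⟨K, P, i, p, h, hP⟩ := exists_isShortExact_free (R := R) Z
      exact ⟨K, P, i, p, .inr (IsSyzygy.succ i p h hP hM).exists_of_succ, .of_projective, h⟩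

end TotallyAcyclic

end GorensteinFlat

/-- For a coherent commutative ring `R` and `n ≥ 0`, the Gorenstein weak global dimension
of `R` is at most `n` iff every injective `R`-module has flat dimension at most `n`. -/
theorem gorensteinWeakGlobalDim_le_iff_injective_flatDim_le (R : Type u) [CommRing R]
    (n : ℕ) (hcoh : IsCoherentRing R) :
    (∀ (M : Type u) [AddCommGroup M] [Module R M], GorensteinFlatDimLE R n M) ↔
    (∀ (I : Type u) [AddCommGroup I] [Module R I],
      Module.Injective R I → FlatDimLE R n I) := by
  constructor
  · intro h I _ _ hI
    obtain ⟨H, hH⟩ := GorensteinFlat.exists_isSyzygy (ModuleCat.of R I) n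
    have hflat : Module.Flat R H := GorensteinFlat.flat_of_torOneVanishes fun B _ _ =>
      hH.torOneVanishes (M := ModuleCat.of R B) hI (h B)
    simpa [FlatDimLE] using hH.flatDimLEAux_of_syzygy (n := 0) hflat
  · intro h M _ _
    have hR : ∀ I : ModuleCat.{u} R, Module.Injective R I → flatDimLEAux R n I :=
      fun I hI => h I hI
    obtain ⟨G, hG⟩ := GorensteinFlat.exists_isSyzygy (ModuleCat.of R M) n
    simpa [GorensteinFlatDimLE] using hG.gorensteinFlatDimLEAux_of_syzygy (n := 0)
      (fun P hP => GorensteinFlat.isGorensteinFlat_of_flat_or_isSyzygy hR (.inl hP))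
      (GorensteinFlat.isGorensteinFlat_of_flat_or_isSyzygy hR (.inr ⟨_, hG⟩))
end

section
/- Let R be a coherent commutative ring and n ≥ 0 an integer. Then every injective R-module has flat dimension at most n if and only if every Gorenstein injective R-module has Gorenstein flat dimension at most n. -/
universe u

section

open CategoryTheory TensorProduct

section CharacterModule

variable {R : Type*} [CommRing R]

theorem Module.Baer.exists_comp_eq {A B Q : Type*} [AddCommGroup A] [Module R A]
    [AddCommGroup B] [Module R B] [AddCommGroup Q] [Module R Q] (hQ : Module.Baer R Q)
    (T : A →ₗ[R] B) (ψ : A →ₗ[R] Q) (h : LinearMap.ker T ≤ LinearMap.ker ψ) :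
    ∃ g : B →ₗ[R] Q, g ∘ₗ T = ψ := by
  obtain ⟨g, hg⟩ := hQ.extension_property ((LinearMap.ker T).liftQ T le_rfl)
    (LinearMap.ker_eq_bot.mp (Submodule.ker_liftQ_eq_bot _ _ _ le_rfl))
    ((LinearMap.ker T).liftQ ψ h)
  refine ⟨g, LinearMap.ext fun x ↦ ?_⟩
  simpa using LinearMap.congr_fun hg (Submodule.Quotient.mk x)

theorem CharacterModule.exists_dual_eq {A B : Type*} [AddCommGroup A] [Module R A]
    [AddCommGroup B] [Module R B] (T : A →ₗ[R] B) (Φ : CharacterModule A)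
    (h : ∀ x, T x = 0 → Φ x = 0) : ∃ Ψ : CharacterModule B, CharacterModule.dual T Ψ = Φ := by
  obtain ⟨g, hg⟩ := (Module.Baer.of_divisible (AddCircle (1 : ℚ))).exists_comp_eq
    (T.toAddMonoidHom.toIntLinearMap) (AddMonoidHom.toIntLinearMap Φ) h
  exact ⟨g.toAddMonoidHom, DFunLike.ext _ _ fun x ↦ LinearMap.congr_fun hg x⟩

theorem CharacterModule.dual_exact {A B C : Type*} [AddCommGroup A] [Module R A]
    [AddCommGroup B] [Module R B] [AddCommGroup C] [Module R C] (i : A →ₗ[R] B) (p : B →ₗ[R] C) (h : Function.Exact i p) :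
    Function.Exact (dual p) (dual i) := by
  intro φ
  constructor
  · intro hφ
    refine exists_dual_eq p φ fun x hx ↦ ?_
    obtain ⟨y, rfl⟩ := (h x).mp hx
    exact DFunLike.congr_fun hφ y
  · rintro ⟨ψ, rfl⟩
    rw [← LinearMap.comp_apply, ← dual_comp, h.linearMap_comp_eq_zero, dual_zero]
    rfl

end CharacterModule

section

variable {R : Type u} [CommRing R]

theorem flat_characterModule_of_injective (hcoh : IsCoherentRing R) (J : Type u) [AddCommGroup J]
    [Module R J] [Module.Injective R J] : Module.Flat R (CharacterModule J) := by
  refine Module.Flat.of_forall_isTrivialRelation fun {l f φ} hφ ↦ ?_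
  let π : (Fin l → R) →ₗ[R] R := Fintype.linearCombination R f
  have hπ : ∀ i, π (Pi.single i 1) = f i := fun i ↦ by simp [π]
  obtain ⟨m, r, hr⟩ : ∃ (m : ℕ) (r : Fin m → (Fin l → R)),
      Submodule.span R (Set.range r) = LinearMap.ker π := by
    have : Module.FinitePresentation R (LinearMap.range π) :=
      hcoh _ (Submodule.fg_range π)
    have h := Module.FinitePresentation.fg_ker π.rangeRestrict π.surjective_rangeRestrict
    rw [LinearMap.ker_rangeRestrict] at h
    exact Submodule.fg_iff_exists_fin_generating_family.mp h
  let T : (Fin l → J) →ₗ[R] (Fin m → J) :=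
    LinearMap.pi fun k ↦ ∑ i, r k i • LinearMap.proj i
  let Φ : CharacterModule (Fin l → J) :=
    ∑ i, (φ i).comp (LinearMap.proj (R := R) (φ := fun _ ↦ J) i).toAddMonoidHom
  have hΦ : ∀ j, Φ j = ∑ i, φ i (j i) := fun j ↦ by
    simp only [Φ]
    exact AddMonoidHom.finsetSum_apply _ _ _
  have hker : ∀ j, T j = 0 → Φ j = 0 := by
    intro j hj
    obtain ⟨g, hg⟩ := (Module.Baer.of_injective ‹Module.Injective R J›).exists_comp_eq π
      (Fintype.linearCombination R j) (by
        rw [← hr, Submodule.span_le]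
        rintro _ ⟨k, rfl⟩
        have := congr_fun hj k
        simpa [T, Fintype.linearCombination_apply] using this)
    have hj' : ∀ i, j i = f i • g 1 := fun i ↦ by
      have := LinearMap.congr_fun hg (Pi.single i 1)
      rw [LinearMap.comp_apply, hπ] at this
      rw [← map_smul, smul_eq_mul, mul_one, this]
      simp
    rw [hΦ]
    calc ∑ i, φ i (j i) = (∑ i, f i • φ i : CharacterModule J) (g 1) := by
          rw [show (∑ i, f i • φ i : CharacterModule J) (g 1) = ∑ i, (f i • φ i) (g 1) from
            AddMonoidHom.finsetSum_apply _ _ _]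
          simp [hj']
      _ = 0 := by rw [hφ]; rfl
  obtain ⟨Ψ, hΨ⟩ := CharacterModule.exists_dual_eq T Φ hker
  refine ⟨m, fun i k ↦ r k i,
    fun k ↦ Ψ.comp (LinearMap.single R (fun _ ↦ J) k).toAddMonoidHom, fun i ↦ ?_, fun k ↦ ?_⟩
  · ext j
    have h1 : Φ (Pi.single i j) = φ i j := by
      rw [hΦ, Finset.sum_eq_single i] <;> simp +contextual
    have h2 : T (Pi.single i j) = ∑ k, Pi.single k (r k i • j) := by
      rw [Finset.univ_sum_single (fun k ↦ r k i • j)]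
      ext k
      simp [T, Pi.single_apply]
    rw [← h1, ← hΨ, CharacterModule.dual_apply]
    erw [AddMonoidHom.comp_apply, AddMonoidHom.finsetSum_apply]
    change Ψ (T _) = _
    rw [h2, map_sum]
    rfl
  · have : r k ∈ LinearMap.ker π := hr ▸ Submodule.subset_span ⟨k, rfl⟩
    simpa [π, Fintype.linearCombination_apply, mul_comm] using this

theorem shortExact_dual {K F M : Type u} [AddCommGroup K] [Module R K] [AddCommGroup F]
    [Module R F] [AddCommGroup M] [Module R M] (i : K →ₗ[R] F) (p : F →ₗ[R] M)
    (hi : Function.Injective i) (hp : Function.Surjective p) (hip : Function.Exact i p) :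
    ∃ S : ShortComplex (ModuleCat.{u} R), S.ShortExact ∧
      S.X₁ = ModuleCat.of R (CharacterModule M) ∧ S.X₂ = ModuleCat.of R (CharacterModule F) ∧
      S.X₃ = ModuleCat.of R (CharacterModule K) := by
  refine ⟨.mk (ModuleCat.ofHom (CharacterModule.dual p)) (ModuleCat.ofHom (CharacterModule.dual i))
    ?_, ModuleCat.shortComplex_shortExact _ ?_ ?_ ?_, rfl, rfl, rfl⟩
  · rw [← ModuleCat.ofHom_comp, ← CharacterModule.dual_comp, hip.linearMap_comp_eq_zero,
      CharacterModule.dual_zero]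
    rfl
  · exact CharacterModule.dual_exact i p hip
  · exact CharacterModule.dual_injective_of_surjective p hp
  · exact CharacterModule.dual_surjective_of_injective i hi

theorem injective_characterModule_object_iff (M : Type u) [AddCommGroup M] [Module R M] :
    Injective (ModuleCat.of R (CharacterModule M)) ↔ Module.Flat R M := by
  rw [← Module.injective_iff_injective_object, Module.Flat.iff_characterModule_injective]

theorem hasInjectiveDimensionLE_characterModule_ker {n : ℕ} {F M : Type u} [AddCommGroup F]
    [Module R F] [AddCommGroup M] [Module R M] [hF : Module.Flat R F] (p : F →ₗ[R] M)
    (hp : Function.Surjective p) :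
    HasInjectiveDimensionLE (ModuleCat.of R (CharacterModule (LinearMap.ker p))) n ↔
      HasInjectiveDimensionLE (ModuleCat.of R (CharacterModule M)) (n + 1) := by
  obtain ⟨S, hS, h1, h2, h3⟩ := shortExact_dual (LinearMap.ker p).subtype p
    (Submodule.injective_subtype _) hp (LinearMap.exact_subtype_ker_map p)
  rw [← h3, ← h1]
  exact hS.hasInjectiveDimensionLT_X₃_iff n
    (h2 ▸ (injective_characterModule_object_iff F).mpr hF)

theorem flatDimLEAux_iff_hasInjectiveDimensionLE (n : ℕ) (M : ModuleCat.{u} R) :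
    flatDimLEAux R n M ↔ HasInjectiveDimensionLE (ModuleCat.of R (CharacterModule M)) n := by
  induction n generalizing M with
  | zero =>
    rw [HasInjectiveDimensionLE, zero_add, ← injective_iff_hasInjectiveDimensionLT_one,
      injective_characterModule_object_iff]
    rfl
  | succ n ih =>
    constructor
    · rintro ⟨F, f, hf, hF, hK⟩
      exact (hasInjectiveDimensionLE_characterModule_ker f hf).mp ((ih _).mp hK)
    · intro h
      have hs := Finsupp.linearCombination_id_surjective R M
      exact ⟨ModuleCat.of R (M →₀ R), Finsupp.linearCombination R id, hs, inferInstance,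
        (ih _).mpr ((hasInjectiveDimensionLE_characterModule_ker _ hs).mpr h)⟩

theorem flatDimLEAux_ker {n : ℕ} {F M : ModuleCat.{u} R} [Module.Flat R F] (p : F →ₗ[R] M)
    (hp : Function.Surjective p) (hM : flatDimLEAux R (n + 1) M) :
    flatDimLEAux R n (ModuleCat.of R (LinearMap.ker p)) := by
  rw [flatDimLEAux_iff_hasInjectiveDimensionLE] at hM ⊢
  exact (hasInjectiveDimensionLE_characterModule_ker p hp).mpr hM

theorem flatDimLEAux_of_retract {n : ℕ} {M N : ModuleCat.{u} R} (i : M →ₗ[R] N) (p : N →ₗ[R] M)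
    (h : p ∘ₗ i = LinearMap.id) (hN : flatDimLEAux R n N) : flatDimLEAux R n M := by
  rw [flatDimLEAux_iff_hasInjectiveDimensionLE] at hN ⊢
  exact Retract.hasInjectiveDimensionLT (Y := ModuleCat.of R (CharacterModule N))
    ⟨ModuleCat.ofHom (CharacterModule.dual p), ModuleCat.ofHom (CharacterModule.dual i), by
      rw [← ModuleCat.ofHom_comp, ← CharacterModule.dual_comp, h]
      rfl⟩ _

theorem flatDimLEAux_of_equiv {n : ℕ} {M N : ModuleCat.{u} R} (e : M ≃ₗ[R] N)
    (hN : flatDimLEAux R n N) : flatDimLEAux R n M :=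
  flatDimLEAux_of_retract e.toLinearMap e.symm.toLinearMap (by ext; simp) hN

theorem LinearMap.exists_comp_eq_of_surjective {A B Q : Type*} [AddCommGroup A] [Module R A]
    [AddCommGroup B] [Module R B] [AddCommGroup Q] [Module R Q] (q : A →ₗ[R] B)
    (hq : Function.Surjective q) (f : A →ₗ[R] Q) (h : ∀ x, q x = 0 → f x = 0) :
    ∃ g : B →ₗ[R] Q, ∀ x, g (q x) = f x := by
  refine ⟨(LinearMap.ker q).liftQ f h ∘ₗ (q.quotKerEquivOfSurjective hq).symm.toLinearMap,
    fun x ↦ ?_⟩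
  have : (q.quotKerEquivOfSurjective hq).symm (q x) = Submodule.Quotient.mk x := by
    rw [LinearEquiv.symm_apply_eq]
    rfl
  rw [LinearMap.comp_apply, LinearEquiv.coe_coe, this]
  exact Submodule.liftQ_apply _ _ _

/-- `Ext¹(X, J⁺) = 0` for the character module `J⁺` of every injective module `J`, i.e. every
morphism to `J⁺` extends along every monomorphism with cokernel `X`; equivalently,
`Tor₁(J, X) = 0`. -/
def ExtDualInjectiveVanishes (R : Type u) [CommRing R] (X : Type u) [AddCommGroup X]
    [Module R X] : Prop :=
  ∀ (J A B : Type u) [AddCommGroup J] [Module R J] [AddCommGroup A] [Module R A]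
    [AddCommGroup B] [Module R B], Module.Injective R J →
    ∀ (i : A →ₗ[R] B) (p : B →ₗ[R] X), Function.Injective i → Function.Surjective p →
      Function.Exact i p → ∀ φ : A →ₗ[R] CharacterModule J,
        ∃ ψ : B →ₗ[R] CharacterModule J, ∀ x, ψ (i x) = φ x

theorem ExtDualInjectiveVanishes.of_flat (X : Type u) [AddCommGroup X] [Module R X]
    [Module.Flat R X] : ExtDualInjectiveVanishes R X := by
  intro J A B _ _ _ _ _ _ _ i p hi hp hip φ
  have h := LinearMap.lTensor_injective_of_exact_of_flat p hp i hi hip J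
  rw [LinearMap.lTensor_inj_iff_rTensor_inj, rTensor_injective_iff_lcomp_surjective] at h
  obtain ⟨ψ, hψ⟩ := h φ
  exact ⟨ψ, fun x ↦ LinearMap.congr_fun hψ x⟩

theorem ExtDualInjectiveVanishes.of_shortExact {X' X X'' : Type u} [AddCommGroup X']
    [Module R X'] [AddCommGroup X] [Module R X] [AddCommGroup X''] [Module R X'']
    (a : X' →ₗ[R] X) (b : X →ₗ[R] X'') (ha : Function.Injective a)
    (hb : Function.Surjective b) (hab : Function.Exact a b)
    (h' : ExtDualInjectiveVanishes R X') (h'' : ExtDualInjectiveVanishes R X'') :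
    ExtDualInjectiveVanishes R X := by
  intro J A B _ _ _ _ _ _ hJ i p hi hp hip φ
  let B' := LinearMap.ker (b ∘ₗ p)
  have hB' : ∀ y : B', ∃ x, a x = p y := fun y ↦ (hab (p y)).mp y.2
  let q : B' →ₗ[R] X' := (LinearEquiv.ofInjective a ha).symm.toLinearMap ∘ₗ
    (p ∘ₗ B'.subtype).codRestrict (LinearMap.range a) hB'
  have hq : ∀ y, a (q y) = p y := fun y ↦ by
    have := (LinearEquiv.ofInjective a ha).apply_symm_apply
      ((p ∘ₗ B'.subtype).codRestrict (LinearMap.range a) hB' y)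
    exact congr_arg Subtype.val this
  let i' : A →ₗ[R] B' := i.codRestrict B' fun x ↦ by simp [B', hip.apply_apply_eq_zero]
  obtain ⟨ψ', hψ'⟩ := h' J A B' hJ i' q
    (fun x y hxy ↦ hi (congr_arg Subtype.val hxy))
    (fun x ↦ by
      obtain ⟨y, hy⟩ := hp (a x)
      exact ⟨⟨y, by simp [B', hy, hab.apply_apply_eq_zero]⟩, ha (by rw [hq, hy])⟩)
    (fun y ↦ by
      rw [← map_eq_zero_iff a ha, hq, hip]
      exact ⟨fun ⟨x, hx⟩ ↦ ⟨x, Subtype.ext hx⟩, fun ⟨x, hx⟩ ↦ ⟨x, congr_arg Subtype.val hx⟩⟩) φ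
  obtain ⟨ψ, hψ⟩ := h'' J B' B hJ B'.subtype (b ∘ₗ p) (Submodule.injective_subtype _)
    (hb.comp hp) (LinearMap.exact_subtype_ker_map _) ψ'
  exact ⟨ψ, fun x ↦ (hψ (i' x)).trans (hψ' x)⟩

theorem exists_extension_of_lTensor_exact {E₂ E₁ E₀ J : Type*} [AddCommGroup E₂] [Module R E₂]
    [AddCommGroup E₁] [Module R E₁] [AddCommGroup E₀] [Module R E₀] [AddCommGroup J] [Module R J]
    (c : E₂ →ₗ[R] E₁) (e : E₁ →ₗ[R] E₀)
    (h : LinearMap.range (c.lTensor J) = LinearMap.ker (e.lTensor J))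
    (θ : E₁ →ₗ[R] CharacterModule J) (hθ : θ ∘ₗ c = 0) :
    ∃ χ : E₀ →ₗ[R] CharacterModule J, ∀ x, χ (e x) = θ x := by
  let Φ : CharacterModule (J ⊗[R] E₁) :=
    CharacterModule.dual (TensorProduct.comm R J E₁).toLinearMap (CharacterModule.uncurry θ)
  obtain ⟨Ψ, hΨ⟩ := CharacterModule.exists_dual_eq (e.lTensor J) Φ fun x hx ↦ by
    obtain ⟨y, rfl⟩ := h.ge hx
    clear hx
    induction y with
    | zero => simp
    | add y z hy hz => rw [map_add, map_add, hy, hz, add_zero]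
    | tmul j y =>
      have := LinearMap.congr_fun hθ y
      change θ (c y) j = 0
      rw [show θ (c y) = 0 from this]
      rfl
  refine ⟨CharacterModule.curry (CharacterModule.dual (TensorProduct.comm R E₀ J).toLinearMap Ψ),
    fun x ↦ DFunLike.ext _ _ fun j ↦ ?_⟩
  exact DFunLike.congr_fun hΨ (j ⊗ₜ x)

theorem ExtDualInjectiveVanishes.of_lTensor_exact {E₂ E₁ E₀ X : Type u} [AddCommGroup E₂]
    [Module R E₂] [AddCommGroup E₁] [Module R E₁] [AddCommGroup E₀] [Module R E₀]
    [AddCommGroup X] [Module R X] [Module.Flat R E₀]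
    (c : E₂ →ₗ[R] E₁) (e : E₁ →ₗ[R] E₀) (π : E₀ →ₗ[R] X) (hce : e ∘ₗ c = 0)
    (hπ : Function.Surjective π) (heπ : Function.Exact e π)
    (h : ∀ (J : Type u) [AddCommGroup J] [Module R J], Module.Injective R J →
      LinearMap.range (c.lTensor J) = LinearMap.ker (e.lTensor J)) :
    ExtDualInjectiveVanishes R X := by
  intro J A B _ _ _ _ _ _ hJ i p hi hp hip φ
  let P : Submodule R (B × E₀) :=
    LinearMap.ker (p ∘ₗ LinearMap.fst R B E₀ - π ∘ₗ LinearMap.snd R B E₀)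
  have hP : ∀ y : B × E₀, y ∈ P ↔ p y.1 = π y.2 := fun y ↦ by simp [P, sub_eq_zero]
  let i' : A →ₗ[R] P := (LinearMap.inl R B E₀ ∘ₗ i).codRestrict P fun x ↦ by
    simp [hP, hip.apply_apply_eq_zero]
  let θ : E₁ →ₗ[R] P := (LinearMap.inr R B E₀ ∘ₗ e).codRestrict P fun x ↦ by
    simp [hP, heπ.apply_apply_eq_zero]
  obtain ⟨ψ, hψ⟩ := ExtDualInjectiveVanishes.of_flat (R := R) E₀ J A P hJ i'
    (LinearMap.snd R B E₀ ∘ₗ P.subtype)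
    (fun x y hxy ↦ hi (congr_arg (fun z : P ↦ z.1.1) hxy))
    (fun y ↦ by
      obtain ⟨x, hx⟩ := hp (π y)
      exact ⟨⟨(x, y), (hP _).mpr hx⟩, rfl⟩)
    (fun y ↦ by
      constructor
      · intro hy
        have hy' : y.1.2 = 0 := hy
        have h0 : p y.1.1 = 0 := by rw [(hP _).mp y.2, hy', map_zero]
        obtain ⟨x, hx⟩ := (hip _).mp h0
        exact ⟨x, Subtype.ext (Prod.ext hx hy'.symm)⟩
      · rintro ⟨x, rfl⟩
        rfl) φ
  obtain ⟨χ, hχ⟩ := exists_extension_of_lTensor_exact c e (h J hJ) (ψ ∘ₗ θ) (by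
    have : θ ∘ₗ c = 0 := LinearMap.ext fun x ↦
      Subtype.ext (Prod.ext rfl (LinearMap.congr_fun hce x))
    rw [LinearMap.comp_assoc, this, LinearMap.comp_zero])
  obtain ⟨g, hg⟩ := LinearMap.exists_comp_eq_of_surjective
    (LinearMap.fst R B E₀ ∘ₗ P.subtype)
    (fun y ↦ by
      obtain ⟨x, hx⟩ := hπ (p y)
      exact ⟨⟨(y, x), (hP _).mpr hx.symm⟩, rfl⟩)
    (ψ - χ ∘ₗ LinearMap.snd R B E₀ ∘ₗ P.subtype)
    (fun y hy ↦ by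
      have hy' : y.1.1 = 0 := hy
      have h0 : π y.1.2 = 0 := by rw [← (hP _).mp y.2, hy', map_zero]
      obtain ⟨x, hx⟩ := (heπ _).mp h0
      have hyx : y = θ x := Subtype.ext (Prod.ext hy' hx.symm)
      change ψ y - χ y.1.2 = 0
      rw [← hx, hχ, hyx, LinearMap.comp_apply, sub_self])
  refine ⟨g, fun x ↦ (hg (i' x)).trans ?_⟩
  change ψ (i' x) - χ 0 = _
  rw [hψ, map_zero, sub_zero]

theorem ExtDualInjectiveVanishes.of_equiv {X Y : Type u} [AddCommGroup X] [Module R X]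
    [AddCommGroup Y] [Module R Y] (e : X ≃ₗ[R] Y) (h : ExtDualInjectiveVanishes R Y) :
    ExtDualInjectiveVanishes R X := by
  intro J A B _ _ _ _ _ _ hJ i p hi hp hip φ
  exact h J A B hJ i (e.toLinearMap ∘ₗ p) hi (e.surjective.comp hp)
    (fun y ↦ by simpa using hip y) φ

theorem IsGorensteinFlat.extDualInjectiveVanishes {X : Type u} [AddCommGroup X] [Module R X]
    (h : IsGorensteinFlat R X) : ExtDualInjectiveVanishes R X := by
  obtain ⟨F, d, hF, hd, ⟨e⟩, hT⟩ := h
  have key : ∀ i k : ℤ, i + 1 + 1 = k → ExtDualInjectiveVanishes R (LinearMap.range (d k)) := by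
    rintro i _ rfl
    have := hF (i + 1 + 1)
    refine .of_lTensor_exact (d i) (d (i + 1)) (d (i + 1 + 1)).rangeRestrict
      (LinearMap.range_le_ker_iff.mp (hd i).le) (d (i + 1 + 1)).surjective_rangeRestrict
      (LinearMap.exact_iff.mpr ?_) fun J _ _ hJ ↦ hT (ModuleCat.of R J) hJ i
    rw [LinearMap.ker_rangeRestrict, hd]
  exact .of_equiv e (key (-2) 0 rfl)

theorem LinearMap.range_eq_ker_of_contraction {X Y Z : Type*} [AddCommGroup X] [Module R X]
    [AddCommGroup Y] [Module R Y] [AddCommGroup Z] [Module R Z] (d : X →ₗ[R] Y) (d' : Y →ₗ[R] Z)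
    (s : Y →ₗ[R] X) (s' : Z →ₗ[R] Y) (hd : d' ∘ₗ d = 0)
    (h : d ∘ₗ s + s' ∘ₗ d' = LinearMap.id) : LinearMap.range d = LinearMap.ker d' := by
  refine le_antisymm (LinearMap.range_le_ker_iff.mpr hd) fun y (hy : d' y = 0) ↦ ⟨s y, ?_⟩
  simpa [hy] using LinearMap.congr_fun h y

/-- The differential `(x, y) ↦ (y, 0)` of the contractible complex with terms `M × M`. -/
def shiftProd (R : Type u) [CommRing R] (M : Type*) [AddCommGroup M] [Module R M] :
    M × M →ₗ[R] M × M :=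
  LinearMap.inl R M M ∘ₗ LinearMap.snd R M M

/-- The contracting homotopy `(x, y) ↦ (0, x)` of `shiftProd`. -/
def shiftProdHomotopy (R : Type u) [CommRing R] (M : Type*) [AddCommGroup M] [Module R M] :
    M × M →ₗ[R] M × M :=
  LinearMap.inr R M M ∘ₗ LinearMap.fst R M M

theorem shiftProd_comp_shiftProd (M : Type*) [AddCommGroup M] [Module R M] :
    shiftProd R M ∘ₗ shiftProd R M = 0 := rfl

theorem shiftProd_comp_homotopy (M : Type*) [AddCommGroup M] [Module R M] :
    shiftProd R M ∘ₗ shiftProdHomotopy R M + shiftProdHomotopy R M ∘ₗ shiftProd R M =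
      LinearMap.id := by
  ext x <;> simp [shiftProd, shiftProdHomotopy]

theorem range_shiftProd (M : Type*) [AddCommGroup M] [Module R M] :
    LinearMap.range (shiftProd R M) = LinearMap.ker (shiftProd R M) :=
  LinearMap.range_eq_ker_of_contraction _ _ _ _ (shiftProd_comp_shiftProd M)
    (shiftProd_comp_homotopy M)

theorem nonempty_equiv_range_shiftProd (M : Type*) [AddCommGroup M] [Module R M] :
    Nonempty (M ≃ₗ[R] LinearMap.range (shiftProd R M)) := by
  have h : LinearMap.range (LinearMap.inl R M M) = LinearMap.range (shiftProd R M) :=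
    (LinearMap.range_comp_of_range_eq_top _
      (LinearMap.range_eq_top.mpr LinearMap.snd_surjective)).symm
  exact ⟨(LinearEquiv.ofInjective _ LinearMap.inl_injective).trans (LinearEquiv.ofEq _ _ h)⟩

theorem Module.Flat.prod (M N : Type u) [AddCommGroup M] [Module R M] [AddCommGroup N]
    [Module R N] [hM : Module.Flat R M] [hN : Module.Flat R N] : Module.Flat R (M × N) := by
  rw [Module.Flat.iff_characterModule_injective] at hM hN ⊢
  refine ⟨fun X Y _ _ _ _ f hf g ↦ ?_⟩
  obtain ⟨a, ha⟩ := hM.out f hf (CharacterModule.dual (LinearMap.inl R M N) ∘ₗ g)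
  obtain ⟨b, hb⟩ := hN.out f hf (CharacterModule.dual (LinearMap.inr R M N) ∘ₗ g)
  refine ⟨CharacterModule.dual (LinearMap.fst R M N) ∘ₗ a +
    CharacterModule.dual (LinearMap.snd R M N) ∘ₗ b, fun x ↦ DFunLike.ext _ _ fun z ↦ ?_⟩
  change a (f x) z.1 + b (f x) z.2 = g x z
  rw [ha, hb]
  change g x (z.1, 0) + g x (0, z.2) = _
  rw [← map_add, Prod.mk_add_mk, add_zero, zero_add]

theorem IsGorensteinFlat.of_flat (M : Type u) [AddCommGroup M] [Module R M] [Module.Flat R M] :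
    IsGorensteinFlat R M := by
  refine ⟨fun _ ↦ ModuleCat.of R (M × M), fun _ ↦ shiftProd R M,
    fun _ ↦ Module.Flat.prod M M, fun _ ↦ range_shiftProd M,
    nonempty_equiv_range_shiftProd M, fun I _ _ ↦ ?_⟩
  refine LinearMap.range_eq_ker_of_contraction _ _ ((shiftProdHomotopy R M).lTensor I)
    ((shiftProdHomotopy R M).lTensor I) ?_ ?_
  · rw [← LinearMap.lTensor_comp]
    exact (congr_arg _ (shiftProd_comp_shiftProd M)).trans (LinearMap.lTensor_zero _)
  · rw [← LinearMap.lTensor_comp, ← LinearMap.lTensor_comp, ← LinearMap.lTensor_add]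
    exact (congr_arg _ (shiftProd_comp_homotopy M)).trans (LinearMap.lTensor_id _ _)

theorem Module.Injective.prod {M N : Type u} [AddCommGroup M] [Module R M] [AddCommGroup N]
    [Module R N] [hM : Module.Injective R M] [hN : Module.Injective R N] :
    Module.Injective R (M × N) where
  out _ _ _ _ _ _ f hf g := by
    obtain ⟨a, ha⟩ := hM.out f hf (LinearMap.fst R M N ∘ₗ g)
    obtain ⟨b, hb⟩ := hN.out f hf (LinearMap.snd R M N ∘ₗ g)
    exact ⟨a.prod b, fun x ↦ Prod.ext (ha x) (hb x)⟩

theorem IsGorensteinInjective.of_injective (M : Type u) [AddCommGroup M] [Module R M]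
    [Module.Injective R M] : IsGorensteinInjective R M := by
  refine ⟨fun _ ↦ ModuleCat.of R (M × M), fun _ ↦ shiftProd R M,
    fun _ ↦ Module.Injective.prod, fun _ ↦ range_shiftProd M,
    nonempty_equiv_range_shiftProd M, fun J _ _ f hf ↦ ⟨shiftProdHomotopy R M ∘ₗ f, ?_⟩⟩
  ext x : 1
  have h := LinearMap.congr_fun (shiftProd_comp_homotopy (R := R) M) (f x)
  have h0 : shiftProd R M (f x) = 0 := LinearMap.congr_fun hf x
  rw [LinearMap.add_apply, LinearMap.comp_apply, LinearMap.comp_apply, h0, map_zero,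
    add_zero] at h
  exact h.symm

theorem IsGorensteinFlat.exists_embedding {X : Type u} [AddCommGroup X] [Module R X]
    (h : IsGorensteinFlat R X) : ∃ (F C : ModuleCat.{u} R) (i : X →ₗ[R] F) (p : F →ₗ[R] C),
      Module.Flat R F ∧ Function.Injective i ∧ Function.Surjective p ∧ Function.Exact i p ∧
        IsGorensteinFlat R C := by
  obtain ⟨F, d, hF, hd, ⟨e⟩, hT⟩ := h
  refine ⟨F (0 + 1), ModuleCat.of R (LinearMap.range (d (0 + 1))),
    (LinearMap.range (d 0)).subtype ∘ₗ e.toLinearMap, (d (0 + 1)).rangeRestrict, hF _,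
    (Submodule.injective_subtype _).comp e.injective, LinearMap.surjective_rangeRestrict _, ?_,
    fun i ↦ F (i + 1), fun i ↦ d (i + 1), fun i ↦ hF _, fun i ↦ hd _,
    ⟨LinearEquiv.refl R _⟩, fun I hI i ↦ hT I hI _⟩
  rw [LinearMap.exact_iff, LinearMap.ker_rangeRestrict, ← hd, LinearMap.range_comp,
    LinearEquiv.range, Submodule.map_top, Submodule.range_subtype]

/-- The smallest class of modules containing the Gorenstein flat ones and closed under
extensions. -/
inductive IsGorensteinFlatFiltered (R : Type u) [CommRing R] : ModuleCat.{u} R → Prop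
  | base {X : ModuleCat.{u} R} (h : IsGorensteinFlat R X) : IsGorensteinFlatFiltered R X
  | extension {X Y Z : ModuleCat.{u} R} (f : X →ₗ[R] Y) (g : Y →ₗ[R] Z)
      (hf : Function.Injective f) (hg : Function.Surjective g) (hfg : Function.Exact f g)
      (hX : IsGorensteinFlatFiltered R X) (hZ : IsGorensteinFlatFiltered R Z) :
      IsGorensteinFlatFiltered R Y

theorem IsGorensteinFlatFiltered.extDualInjectiveVanishes {X : ModuleCat.{u} R}
    (h : IsGorensteinFlatFiltered R X) : ExtDualInjectiveVanishes R X := by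
  induction h with
  | base h => exact h.extDualInjectiveVanishes
  | extension f g hf hg hfg _ _ hX hZ => exact .of_shortExact f g hf hg hfg hX hZ

namespace CharacterModule

/-- The evaluation map from a module to its double character module. -/
def eval (R : Type u) [CommRing R] (M : Type*) [AddCommGroup M] [Module R M] :
    M →ₗ[R] CharacterModule (CharacterModule M) where
  toFun x := AddMonoidHom.eval x
  map_add' x y := DFunLike.ext _ _ fun φ ↦ map_add (φ : M →+ _) x y
  map_smul' _ _ := rfl

theorem eval_apply {M : Type*} [AddCommGroup M] [Module R M] (x : M) (φ : CharacterModule M) :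
    eval R M x φ = φ x := rfl

theorem eval_injective (M : Type*) [AddCommGroup M] [Module R M] :
    Function.Injective (eval R M) :=
  (injective_iff_map_eq_zero _).mpr fun x hx ↦
    eq_zero_of_character_apply fun c ↦ by rw [← eval_apply (R := R) x c, hx]; rfl

theorem dual_eval_comp_eval (M : Type*) [AddCommGroup M] [Module R M] :
    dual (eval R M) ∘ₗ eval R (CharacterModule M) = LinearMap.id := rfl

end CharacterModule

theorem flat_quotient_range_eval (F : Type u) [AddCommGroup F] [Module R F]
    [hD : Module.Flat R (CharacterModule (CharacterModule F))] :
    Module.Flat R (CharacterModule (CharacterModule F) ⧸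
      LinearMap.range (CharacterModule.eval R F)) := by
  let q := (LinearMap.range (CharacterModule.eval R F)).mkQ
  have hinj := CharacterModule.dual_injective_of_surjective q (Submodule.mkQ_surjective _)
  have hex := CharacterModule.dual_exact (CharacterModule.eval R F) q
    (LinearMap.exact_map_mkQ_range _)
  obtain ⟨-, r, hr⟩ := ((Function.Exact.split_tfae' hex).out 0 1 :).mp
    ⟨hinj, _, CharacterModule.dual_eval_comp_eval F⟩
  rw [Module.Flat.iff_characterModule_injective] at hD ⊢
  refine ⟨fun X Y _ _ _ _ f hf g ↦ ?_⟩
  obtain ⟨h, hh⟩ := hD.out f hf (CharacterModule.dual q ∘ₗ g)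
  refine ⟨r ∘ₗ h, fun x ↦ ?_⟩
  rw [LinearMap.comp_apply, hh]
  exact LinearMap.congr_fun hr (g x)

theorem IsGorensteinFlatFiltered.exists_embedding (hcoh : IsCoherentRing R)
    {X : ModuleCat.{u} R} (h : IsGorensteinFlatFiltered R X) :
    ∃ (F C : ModuleCat.{u} R) (i : X →ₗ[R] F) (p : F →ₗ[R] C),
      Module.Flat R F ∧ Function.Injective i ∧ Function.Surjective p ∧ Function.Exact i p ∧
        IsGorensteinFlatFiltered R C := by
  induction h with
  | base h =>
    obtain ⟨F, C, i, p, hF, hi, hp, hip, hC⟩ := h.exists_embedding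
    exact ⟨F, C, i, p, hF, hi, hp, hip, .base hC⟩
  | @extension X Y Z f g hf hg hfg hX hZ ihX ihZ =>
    obtain ⟨F₁, C₁, i₁, p₁, hF₁, hi₁, hp₁, hip₁, hC₁⟩ := ihX
    obtain ⟨F₂, C₂, i₂, p₂, hF₂, hi₂, hp₂, hip₂, hC₂⟩ := ihZ
    have hJ : Module.Injective R (CharacterModule F₁) :=
      Module.Flat.iff_characterModule_injective.mp hF₁
    let D := CharacterModule (CharacterModule F₁)
    have hD : Module.Flat R D := flat_characterModule_of_injective hcoh _
    let ε : F₁ →ₗ[R] D := CharacterModule.eval R F₁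
    have hε : Function.Injective ε := CharacterModule.eval_injective F₁
    obtain ⟨η, hη⟩ := hZ.extDualInjectiveVanishes (CharacterModule F₁) X Y hJ f g hf hg hfg
      (ε ∘ₗ i₁)
    let N := LinearMap.range (ε ∘ₗ i₁)
    have hN : IsGorensteinFlatFiltered R (ModuleCat.of R (D ⧸ N)) := by
      obtain ⟨a, ha⟩ := LinearMap.exists_comp_eq_of_surjective p₁ hp₁ (N.mkQ ∘ₗ ε) fun x hx ↦ by
        obtain ⟨y, rfl⟩ := (hip₁ x).mp hx
        exact (Submodule.Quotient.mk_eq_zero N).mpr ⟨y, rfl⟩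
      have hflat : Module.Flat R (D ⧸ LinearMap.range ε) := flat_quotient_range_eval F₁
      refine .extension (Z := ModuleCat.of R (D ⧸ LinearMap.range ε)) a
        (Submodule.factor (LinearMap.range_comp_le_range i₁ ε)) ?_
        (Submodule.factor_surjective _) ?_ hC₁ (.base (.of_flat _))
      · refine (injective_iff_map_eq_zero a).mpr fun c hc ↦ ?_
        obtain ⟨y, rfl⟩ := hp₁ c
        rw [ha] at hc
        obtain ⟨x, hx⟩ := (Submodule.Quotient.mk_eq_zero N).mp hc
        rw [← hε hx, hip₁.apply_apply_eq_zero]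
      · intro c
        obtain ⟨y, rfl⟩ := N.mkQ_surjective c
        constructor
        · intro hy
          obtain ⟨x, rfl⟩ := (Submodule.Quotient.mk_eq_zero _).mp hy
          exact ⟨p₁ x, ha x⟩
        · rintro ⟨c, hc⟩
          obtain ⟨x, rfl⟩ := hp₁ c
          rw [← hc, ha]
          exact (Submodule.Quotient.mk_eq_zero _).mpr ⟨x, rfl⟩
    let k : Y →ₗ[R] D × F₂ := η.prod (i₂ ∘ₗ g)
    let P := LinearMap.range k
    have hk : ∀ y, k y = (η y, i₂ (g y)) := fun _ ↦ rfl
    have hflat : Module.Flat R (D × F₂) := Module.Flat.prod _ _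
    refine ⟨ModuleCat.of R (D × F₂), ModuleCat.of R ((D × F₂) ⧸ P), k, P.mkQ, hflat, ?_,
      P.mkQ_surjective, LinearMap.exact_map_mkQ_range k, ?_⟩
    · refine (injective_iff_map_eq_zero k).mpr fun y hy ↦ ?_
      rw [hk, Prod.mk_eq_zero, map_eq_zero_iff i₂ hi₂] at hy
      obtain ⟨x, rfl⟩ := (hfg y).mp hy.2
      rw [hη] at hy
      rw [(map_eq_zero_iff (ε ∘ₗ i₁) (hε.comp hi₁)).mp hy.1, map_zero]
    let a : D ⧸ N →ₗ[R] (D × F₂) ⧸ P := N.mapQ P (LinearMap.inl R D F₂) (by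
      rintro _ ⟨x, rfl⟩
      exact ⟨f x, by rw [hk, hη, hfg.apply_apply_eq_zero, map_zero]; rfl⟩)
    let b : (D × F₂) ⧸ P →ₗ[R] C₂ := P.liftQ (p₂ ∘ₗ LinearMap.snd R D F₂) (by
      rintro _ ⟨y, rfl⟩
      exact hip₂.apply_apply_eq_zero (g y))
    refine .extension (X := ModuleCat.of R (D ⧸ N)) a b ?_ ?_ ?_ hN hC₂
    · refine (injective_iff_map_eq_zero a).mpr fun c hc ↦ ?_
      obtain ⟨d, rfl⟩ := N.mkQ_surjective c
      obtain ⟨y, hy⟩ := (Submodule.Quotient.mk_eq_zero P).mp hc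
      rw [hk, LinearMap.inl_apply, Prod.mk_inj, map_eq_zero_iff i₂ hi₂] at hy
      obtain ⟨x, rfl⟩ := (hfg y).mp hy.2
      exact (Submodule.Quotient.mk_eq_zero N).mpr ⟨x, by rw [← hy.1, hη]⟩
    · intro c
      obtain ⟨y, rfl⟩ := hp₂ c
      exact ⟨P.mkQ (0, y), rfl⟩
    · intro c
      obtain ⟨⟨d, z⟩, rfl⟩ := P.mkQ_surjective c
      constructor
      · intro hz
        obtain ⟨w, rfl⟩ := (hip₂ z).mp hz
        obtain ⟨y, rfl⟩ := hg w
        refine ⟨N.mkQ (d - η y), (Submodule.Quotient.eq P).mpr ⟨-y, ?_⟩⟩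
        simp [hk]
      · rintro ⟨c, hc⟩
        obtain ⟨d, rfl⟩ := N.mkQ_surjective c
        rw [← hc]
        exact map_zero p₂

theorem gorensteinFlatDimLEAux.exists_embedding (hcoh : IsCoherentRing R) {n : ℕ}
    {M : ModuleCat.{u} R} (h : gorensteinFlatDimLEAux R n M) :
    ∃ (N C : ModuleCat.{u} R) (i : M →ₗ[R] N) (p : N →ₗ[R] C),
      flatDimLEAux R n N ∧ Function.Injective i ∧ Function.Surjective p ∧ Function.Exact i p ∧
        IsGorensteinFlatFiltered R C := by
  induction n generalizing M with
  | zero => exact IsGorensteinFlatFiltered.exists_embedding hcoh (.base h)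
  | succ n ih =>
    obtain ⟨G, f, hf, hG, hK⟩ := h
    obtain ⟨N, C, i, p, hN, hi, hp, hip, hC⟩ := ih hK
    change LinearMap.ker f →ₗ[R] N at i
    let k : LinearMap.ker f →ₗ[R] N × G := i.prod (-(LinearMap.ker f).subtype)
    have hk : ∀ x, k x = (i x, -x.1) := fun _ ↦ rfl
    let P := LinearMap.range k
    let a : G →ₗ[R] (N × G) ⧸ P := P.mkQ ∘ₗ LinearMap.inr R N G
    let b : N →ₗ[R] (N × G) ⧸ P := P.mkQ ∘ₗ LinearMap.inl R N G
    let q : (N × G) ⧸ P →ₗ[R] C := P.liftQ (p ∘ₗ LinearMap.fst R N G) (by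
      rintro _ ⟨x, rfl⟩
      exact hip.apply_apply_eq_zero x)
    have hab : ∀ x : LinearMap.ker f, a x = b (i x) := fun x ↦
      (Submodule.Quotient.eq P).mpr ⟨-x, by simp [hk]⟩
    have hab' : ∀ y z, a y = b z → f y = 0 := fun y z hyz ↦ by
      obtain ⟨x, hx⟩ := (Submodule.Quotient.eq P).mp hyz
      have h2 := congr_arg Prod.snd hx
      simp only [hk, LinearMap.inr_apply, LinearMap.inl_apply, Prod.snd_sub, sub_zero] at h2
      rw [← h2, map_neg, LinearMap.mem_ker.mp x.2, neg_zero]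
    have hb : Function.Injective b := (injective_iff_map_eq_zero b).mpr fun z hz ↦ by
      obtain ⟨x, hx⟩ := (Submodule.Quotient.mk_eq_zero P).mp hz
      rw [hk, LinearMap.inl_apply, Prod.mk_inj, neg_eq_zero, ZeroMemClass.coe_eq_zero] at hx
      rw [← hx.1, hx.2, map_zero]
    have hE : IsGorensteinFlatFiltered R (ModuleCat.of R ((N × G) ⧸ P)) := by
      refine .extension a q ?_ ?_ ?_ (.base hG) hC
      · refine (injective_iff_map_eq_zero a).mpr fun y hy ↦ ?_
        obtain ⟨x, hx⟩ := (Submodule.Quotient.mk_eq_zero P).mp hy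
        rw [hk, LinearMap.inr_apply, Prod.mk_inj, map_eq_zero_iff i hi] at hx
        rw [← hx.2, hx.1, ZeroMemClass.coe_zero, neg_zero]
      · intro c
        obtain ⟨y, rfl⟩ := hp c
        exact ⟨P.mkQ (y, 0), rfl⟩
      · intro c
        obtain ⟨⟨z, y⟩, rfl⟩ := P.mkQ_surjective c
        constructor
        · intro hz
          obtain ⟨x, rfl⟩ := (hip z).mp hz
          change LinearMap.ker f at x
          exact ⟨y + x, (Submodule.Quotient.eq P).mpr ⟨-x, by simp [hk]⟩⟩
        · rintro ⟨y', hy'⟩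
          rw [← hy']
          exact map_zero p
    obtain ⟨F, C', j, r, hF, hj, hr, hjr, hC'⟩ := hE.exists_embedding hcoh
    change (N × G) ⧸ P →ₗ[R] F at j
    let Q := LinearMap.range (j ∘ₗ b)
    obtain ⟨m, hm⟩ := LinearMap.exists_comp_eq_of_surjective f hf (Q.mkQ ∘ₗ j ∘ₗ a) fun x hx ↦
      (Submodule.Quotient.mk_eq_zero Q).mpr ⟨i ⟨x, hx⟩, congr_arg j (hab ⟨x, hx⟩).symm⟩
    let s : F ⧸ Q →ₗ[R] C' := Q.liftQ r (by
      rintro _ ⟨x, rfl⟩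
      exact hjr.apply_apply_eq_zero (b x))
    refine ⟨ModuleCat.of R (F ⧸ Q), C', m, s, ⟨F, Q.mkQ, Q.mkQ_surjective, hF, ?_⟩, ?_, ?_, ?_,
      hC'⟩
    · refine flatDimLEAux_of_equiv (N := N) ?_ hN
      exact (LinearEquiv.ofEq _ _ Q.ker_mkQ).trans
        (LinearEquiv.ofInjective (j ∘ₗ b) (hj.comp hb)).symm
    · refine (injective_iff_map_eq_zero m).mpr fun x hx ↦ ?_
      obtain ⟨y, rfl⟩ := hf x
      rw [hm] at hx
      obtain ⟨z, hz⟩ := (Submodule.Quotient.mk_eq_zero Q).mp hx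
      exact hab' y z (hj hz).symm
    · intro c
      obtain ⟨y, rfl⟩ := hr c
      exact ⟨Q.mkQ y, rfl⟩
    · intro c
      obtain ⟨y, rfl⟩ := Q.mkQ_surjective c
      constructor
      · intro hy
        obtain ⟨e, rfl⟩ := (hjr y).mp hy
        obtain ⟨⟨z, g⟩, rfl⟩ := P.mkQ_surjective e
        refine ⟨f g, ?_⟩
        rw [hm]
        refine (Submodule.Quotient.eq Q).mpr ⟨-z, ?_⟩
        change j (P.mkQ (-z, 0)) = j (P.mkQ (0, g)) - j (P.mkQ (z, g))
        rw [← map_sub, ← map_sub]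
        simp
      · rintro ⟨x, hx⟩
        obtain ⟨g, rfl⟩ := hf x
        rw [← hx, hm]
        exact hjr.apply_apply_eq_zero (a g)

theorem flatDimLE_of_injective_of_gorensteinFlatDimLE (hcoh : IsCoherentRing R) {n : ℕ}
    {I : Type u} [AddCommGroup I] [Module R I] [hI : Module.Injective R I]
    (h : GorensteinFlatDimLE R n I) : FlatDimLE R n I := by
  obtain ⟨N, C, i, p, hN, hi, -⟩ := gorensteinFlatDimLEAux.exists_embedding hcoh h
  obtain ⟨r, hr⟩ := hI.out i hi LinearMap.id
  exact flatDimLEAux_of_retract i r (LinearMap.ext hr) hN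

section Totalization

variable {Z I : ℤ → ModuleCat.{u} R} (f : ∀ i, Z i →ₗ[R] I i) (g : ∀ i, I i →ₗ[R] Z (i + 1))

theorem lTensor_injective_of_flatDimLEAux (hfg : ∀ i, Function.Exact (f i) (g i))
    (hf : ∀ i, Function.Injective (f i)) (hg : ∀ i, Function.Surjective (g i))
    (hI : ∀ i, Module.Flat R (I i)) {m : ℕ} {J : ModuleCat.{u} R} (hJ : flatDimLEAux R m J)
    (i : ℤ) : Function.Injective ((f i).lTensor J) := by
  induction m generalizing J i with
  | zero =>
    have : Module.Flat R J := hJ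
    exact Module.Flat.lTensor_preserves_injective_linearMap _ (hf i)
  | succ m ih =>
    obtain ⟨Q, q, hq, hQ, hK⟩ := hJ
    refine lTensor_injective_of_exact_of_exact_of_rTensor_injective
      (f₁ := (LinearMap.ker q).subtype) (LinearMap.exact_subtype_ker_map q) hq (hfg i) (hg i) ?_
      (Module.Flat.lTensor_preserves_injective_linearMap _ (hf i))
    have hI' := hI (i + 1)
    have h := (Module.Flat.rTensor_preserves_injective_linearMap (M := I (i + 1))
      (LinearMap.ker q).subtype Subtype.val_injective).comp (ih hK (i + 1))
    refine Function.Injective.of_comp (f := (f (i + 1)).lTensor Q) ?_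
    rw [← LinearMap.coe_comp, LinearMap.lTensor_comp_rTensor, ← LinearMap.rTensor_comp_lTensor]
    exact h

theorem isGorensteinFlat_of_exact (hfg : ∀ i, Function.Exact (f i) (g i))
    (hf : ∀ i, Function.Injective (f i)) (hg : ∀ i, Function.Surjective (g i))
    (hI : ∀ i, Module.Flat R (I i)) {m : ℕ}
    (hm : ∀ J : ModuleCat.{u} R, Module.Injective R J → flatDimLEAux R m J) :
    IsGorensteinFlat R (Z (0 + 1)) := by
  refine ⟨I, fun i ↦ f (i + 1) ∘ₗ g i, hI, fun i ↦ ?_, ⟨?_⟩, fun J hJ i ↦ ?_⟩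
  · rw [LinearMap.range_comp_of_range_eq_top _ (LinearMap.range_eq_top.mpr (hg i)),
      LinearMap.ker_comp_of_ker_eq_bot _ (LinearMap.ker_eq_bot.mpr (hf _)),
      (hfg (i + 1)).linearMap_ker_eq]
  · exact (LinearEquiv.ofInjective _ (hf (0 + 1))).trans (LinearEquiv.ofEq _ _
      (LinearMap.range_comp_of_range_eq_top _ (LinearMap.range_eq_top.mpr (hg 0))).symm)
  · rw [LinearMap.lTensor_comp, LinearMap.lTensor_comp, LinearMap.range_comp_of_range_eq_top _
        (LinearMap.range_eq_top.mpr (LinearMap.lTensor_surjective _ (hg i))),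
      LinearMap.ker_comp_of_ker_eq_bot _ (LinearMap.ker_eq_bot.mpr
        (lTensor_injective_of_flatDimLEAux f g hfg hf hg hI (hm J hJ) _)),
      (lTensor_exact J (hfg (i + 1)) (hg (i + 1))).linearMap_ker_eq]

end Totalization

theorem gorensteinFlatDimLEAux_of_exact {m n : ℕ}
    (hm : ∀ J : ModuleCat.{u} R, Module.Injective R J → flatDimLEAux R m J)
    {Z I : ℤ → ModuleCat.{u} R} (f : ∀ i, Z i →ₗ[R] I i) (g : ∀ i, I i →ₗ[R] Z (i + 1))
    (hfg : ∀ i, Function.Exact (f i) (g i))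
    (hf : ∀ i, Function.Injective (f i)) (hg : ∀ i, Function.Surjective (g i))
    (hI : ∀ i, flatDimLEAux R n (I i)) : gorensteinFlatDimLEAux R n (Z (0 + 1)) := by
  induction n generalizing Z I with
  | zero => exact isGorensteinFlat_of_exact f g hfg hf hg hI hm
  | succ n ih =>
    let Q (i : ℤ) := Z i →₀ R
    let p (i : ℤ) : Q i →ₗ[R] Z i := Finsupp.linearCombination R id
    have hp (i : ℤ) : Function.Surjective (p i) := Finsupp.linearCombination_id_surjective R _
    have hs (i : ℤ) : ∃ s : Q (i + 1) →ₗ[R] I i, g i ∘ₗ s = p (i + 1) :=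
      Module.projective_lifting_property (g i) (p (i + 1)) (hg i)
    choose s hs using hs
    replace hs (i : ℤ) (b : Q (i + 1)) : g i (s i b) = p (i + 1) b :=
      LinearMap.congr_fun (hs i) b
    let t (i : ℤ) : Q i × Q (i + 1) →ₗ[R] I i := (f i ∘ₗ p i).coprod (s i)
    have ht (i : ℤ) (x : Q i × Q (i + 1)) : t i x = f i (p i x.1) + s i x.2 := rfl
    have hgt (i : ℤ) (x : Q i × Q (i + 1)) : g i (t i x) = p (i + 1) x.2 := by
      rw [ht, map_add, (hfg i).apply_apply_eq_zero, zero_add, hs]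
    have ht_surj (i : ℤ) : Function.Surjective (t i) := fun x ↦ by
      obtain ⟨b, hb⟩ := hp (i + 1) (g i x)
      obtain ⟨z, hz⟩ := (hfg i (x - s i b)).mp (by rw [map_sub, hs, hb, sub_self])
      obtain ⟨a, ha⟩ := hp i z
      exact ⟨(a, b), by rw [ht, ha, hz, sub_add_cancel]⟩
    let f' (i : ℤ) : LinearMap.ker (p i) →ₗ[R] LinearMap.ker (t i) :=
      (LinearMap.inl R (Q i) (Q (i + 1))).restrict fun x hx ↦ by
        rw [LinearMap.mem_ker] at hx ⊢
        rw [LinearMap.inl_apply, ht, hx, map_zero, map_zero, add_zero]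
    let g' (i : ℤ) : LinearMap.ker (t i) →ₗ[R] LinearMap.ker (p (i + 1)) :=
      (LinearMap.snd R (Q i) (Q (i + 1))).restrict fun x hx ↦ by
        rw [LinearMap.mem_ker] at hx ⊢
        rw [LinearMap.snd_apply, ← hgt, hx, map_zero]
    refine ⟨ModuleCat.of R (Q (0 + 1)), p (0 + 1), hp _, .of_flat _,
      ih (Z := fun i ↦ ModuleCat.of R (LinearMap.ker (p i)))
        (I := fun i ↦ ModuleCat.of R (LinearMap.ker (t i))) f' g' ?_ ?_ ?_ fun i ↦ ?_⟩
    · rintro i ⟨⟨a, b⟩, hx⟩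
      constructor
      · intro h
        obtain rfl : b = 0 := congr_arg Subtype.val h
        refine ⟨⟨a, ?_⟩, rfl⟩
        rw [LinearMap.mem_ker, ht, map_zero, add_zero] at hx
        exact (map_eq_zero_iff (f i) (hf i)).mp hx
      · rintro ⟨y, hy⟩
        rw [← hy]
        rfl
    · intro i x y h
      exact Subtype.ext (congr_arg (fun z ↦ z.1.1) h)
    · rintro i ⟨b, hb⟩
      rw [LinearMap.mem_ker] at hb
      obtain ⟨z, hz⟩ := (hfg i (-s i b)).mp (by rw [map_neg, hs, hb, neg_zero])
      obtain ⟨a, ha⟩ := hp i z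
      exact ⟨⟨(a, b), by rw [LinearMap.mem_ker, ht, ha, hz, neg_add_cancel]⟩, rfl⟩
    · have : Module.Flat R (ModuleCat.of R (Q i × Q (i + 1))) :=
        inferInstanceAs (Module.Flat R (Q i × Q (i + 1)))
      exact flatDimLEAux_ker (F := ModuleCat.of R (Q i × Q (i + 1))) (t i) (ht_surj i) (hI i)

theorem IsGorensteinFlat.of_equiv {M N : Type u} [AddCommGroup M] [Module R M] [AddCommGroup N]
    [Module R N] (e : M ≃ₗ[R] N) (hN : IsGorensteinFlat R N) : IsGorensteinFlat R M := by
  obtain ⟨F, d, hF, hd, ⟨e'⟩, ht⟩ := hN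
  exact ⟨F, d, hF, hd, ⟨e.trans e'⟩, ht⟩

theorem gorensteinFlatDimLEAux_of_equiv {n : ℕ} {M N : ModuleCat.{u} R} (e : M ≃ₗ[R] N)
    (hN : gorensteinFlatDimLEAux R n N) : gorensteinFlatDimLEAux R n M := by
  cases n with
  | zero => exact IsGorensteinFlat.of_equiv e hN
  | succ n =>
    obtain ⟨G, p, hp, hG, hK⟩ := hN
    have h : LinearMap.ker (e.symm.toLinearMap ∘ₗ p) = LinearMap.ker p :=
      LinearMap.ker_comp_of_ker_eq_bot _ e.symm.ker
    refine ⟨G, e.symm.toLinearMap ∘ₗ p, e.symm.surjective.comp hp, hG, ?_⟩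
    rwa [h]

theorem gorensteinFlatDimLE_of_isGorensteinInjective {n : ℕ}
    (h : ∀ (I : Type u) [AddCommGroup I] [Module R I], Module.Injective R I → FlatDimLE R n I)
    {M : Type u} [AddCommGroup M] [Module R M] (hM : IsGorensteinInjective R M) :
    GorensteinFlatDimLE R n M := by
  obtain ⟨I, d, hI, hd, ⟨e⟩, -⟩ := hM
  let g (i : ℤ) : I i →ₗ[R] LinearMap.ker (d (i + 1)) :=
    (d i).codRestrict _ fun x ↦ hd i ▸ LinearMap.mem_range_self (d i) x
  refine gorensteinFlatDimLEAux_of_equiv (N := ModuleCat.of R (LinearMap.ker (d (0 + 1))))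
    (e.trans (LinearEquiv.ofEq _ _ (hd 0)))
    (gorensteinFlatDimLEAux_of_exact (fun J hJ ↦ h J hJ)
      (Z := fun i ↦ ModuleCat.of R (LinearMap.ker (d i))) (fun i ↦ (LinearMap.ker (d i)).subtype)
      g (fun i x ↦ ?_) (fun i ↦ Subtype.val_injective) (fun i ↦ ?_) fun i ↦ h _ (hI i))
  · constructor
    · intro hx
      exact ⟨⟨x, congr_arg Subtype.val hx⟩, rfl⟩
    · rintro ⟨y, rfl⟩
      exact Subtype.ext y.2
  · rintro ⟨y, hy⟩
    obtain ⟨x, rfl⟩ : y ∈ LinearMap.range (d i) := hd i ▸ hy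
    exact ⟨x, rfl⟩

end

end

/-- For a coherent commutative ring `R` and `n ≥ 0`, every injective `R`-module has flat
dimension at most `n` iff every Gorenstein injective `R`-module has Gorenstein flat
dimension at most `n`. -/
theorem injective_flatDim_le_iff_gorensteinInjective_gorensteinFlatDim_le
    (R : Type u) [CommRing R] (n : ℕ) (hcoh : IsCoherentRing R) :
    (∀ (I : Type u) [AddCommGroup I] [Module R I],
      Module.Injective R I → FlatDimLE R n I) ↔
    (∀ (M : Type u) [AddCommGroup M] [Module R M],
      IsGorensteinInjective R M → GorensteinFlatDimLE R n M) := by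
  exact ⟨fun h _ _ _ hM ↦ gorensteinFlatDimLE_of_isGorensteinInjective h hM,
    fun h I _ _ hI ↦ flatDimLE_of_injective_of_gorensteinFlatDimLE hcoh
      (h I (IsGorensteinInjective.of_injective I))⟩
end

section
/- A commutative ring R is Gorenstein Von Neumann regular (every R-module is Gorenstein flat) if and only if every finitely presented R-module is Gorenstein flat. -/
universe u

/-- A left- and right-total relation admits a bi-infinite chain through any given element. -/
theorem exists_int_chain {α : Type*} (r : α → α → Prop) (hright : ∀ a, ∃ b, r a b)
    (hleft : ∀ b, ∃ a, r a b) (a : α) : ∃ Z : ℤ → α, Z 0 = a ∧ ∀ i, r (Z i) (Z (i + 1)) := by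
  choose f hf using hright
  choose g hg using hleft
  refine ⟨fun i => match i with
    | Int.ofNat n => f^[n] a
    | Int.negSucc n => g^[n + 1] a, rfl, ?_⟩
  rintro (n | _ | n)
  · change r (f^[n] a) (f^[n + 1] a)
    rw [Function.iterate_succ_apply']
    exact hf _
  · exact hg a
  · change r (g^[n + 2] a) (g^[n + 1] a)
    rw [Function.iterate_succ_apply']
    exact hg _

/-- The existence of a short exact sequence `0 → A → F → B → 0` with `F` flat. -/
def HasFlatExtension {R : Type u} [CommRing R] (A B : ModuleCat.{u} R) : Prop :=
  ∃ (F : ModuleCat.{u} R) (j : A →ₗ[R] F) (p : F →ₗ[R] B), Module.Flat R F ∧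
    Function.Injective j ∧ Function.Surjective p ∧ LinearMap.range j = LinearMap.ker p

theorem exists_hasFlatExtension_left {R : Type u} [CommRing R] (B : ModuleCat.{u} R) :
    ∃ A, HasFlatExtension A B :=
  let p := Finsupp.linearCombination R (id : B → B)
  ⟨ModuleCat.of R (LinearMap.ker p), ModuleCat.of R (B →₀ R), (LinearMap.ker p).subtype, p,
    inferInstanceAs (Module.Flat R (B →₀ R)), Subtype.val_injective,
    Finsupp.linearCombination_id_surjective R B, Submodule.range_subtype _⟩

theorem exists_hasFlatExtension_right {R : Type u} [CommRing R]
    (hR : ∀ I : ModuleCat.{u} R, Module.Injective R I → Module.Flat R I) (A : ModuleCat.{u} R) :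
    ∃ B, HasFlatExtension A B := by
  obtain ⟨I, hI, f, hf⟩ := CategoryTheory.EnoughInjectives.presentation A
  have hI' : Module.Injective R I := (Module.injective_iff_injective_object R I).mpr hI
  exact ⟨ModuleCat.of R (I ⧸ LinearMap.range f.hom), I, f.hom, (LinearMap.range f.hom).mkQ,
    hR I hI', (ModuleCat.mono_iff_injective f).mp hf, Submodule.mkQ_surjective _,
    (Submodule.ker_mkQ _).symm⟩

/-- If every injective module is flat, then every module is Gorenstein flat. -/
theorem isGorensteinFlat_of_flat_of_injective {R : Type u} [CommRing R]
    (hR : ∀ I : ModuleCat.{u} R, Module.Injective R I → Module.Flat R I)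
    (M : Type u) [AddCommGroup M] [Module R M] : IsGorensteinFlat R M := by
  obtain ⟨Z, hZ, hstep⟩ := exists_int_chain HasFlatExtension (exists_hasFlatExtension_right hR)
    exists_hasFlatExtension_left (ModuleCat.of R M)
  have hstep' : ∀ i : ℤ, HasFlatExtension (Z (i - 1)) (Z i) := fun i => by
    simpa using hstep (i - 1)
  choose F j p hF hj hp hjp using hstep'
  let e : ∀ i : ℤ, Z i ≃ₗ[R] Z (i + 1 - 1) := fun i =>
    LinearEquiv.cast (R := R) (M := fun k => Z k) (add_sub_cancel_right i 1).symm
  let p' : ∀ i : ℤ, F i →ₗ[R] Z (i + 1 - 1) := fun i => (e i).toLinearMap ∘ₗ p i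
  have hp' : ∀ i, Function.Surjective (p' i) := fun i =>
    (e i).surjective.comp (hp i)
  have hker : ∀ i, LinearMap.ker (p' i) = LinearMap.ker (p i) := fun i =>
    LinearEquiv.ker_comp _ _
  have hrange : ∀ i, LinearMap.range (j (i + 1) ∘ₗ p' i) = LinearMap.range (j (i + 1)) :=
    fun i => LinearMap.range_comp_of_range_eq_top _ (LinearMap.range_eq_top.mpr (hp' i))
  have hexact : ∀ i, LinearMap.range (j (i + 1) ∘ₗ p' i) =
      LinearMap.ker (j (i + 1 + 1) ∘ₗ p' (i + 1)) := fun i => by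
    rw [hrange, LinearMap.ker_comp_of_ker_eq_bot _ (LinearMap.ker_eq_bot.mpr (hj _)), hker, hjp]
  refine ⟨F, fun i => j (i + 1) ∘ₗ p' i, hF, hexact, ?_, fun I hI i => ?_⟩
  · rw [hrange]
    have e : M ≃ₗ[R] Z (0 + 1 - 1) :=
      LinearEquiv.cast (R := R) (M := fun N : ModuleCat.{u} R => N)
        (i := ModuleCat.of R M) (j := Z (0 + 1 - 1)) (by simpa using hZ.symm)
    exact ⟨e.trans (LinearEquiv.ofInjective _ (hj _))⟩
  · have := hR I hI
    exact (LinearMap.exact_iff.mp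
      (Module.Flat.lTensor_exact I (LinearMap.exact_iff.mpr (hexact i).symm))).symm

theorem IsGorensteinFlat.exists_injective_flat {R : Type u} [CommRing R] {M : Type u}
    [AddCommGroup M] [Module R M] (h : IsGorensteinFlat R M) :
    ∃ (F : ModuleCat.{u} R) (j : M →ₗ[R] F), Module.Flat R F ∧ Function.Injective j := by
  obtain ⟨F, d, hF, -, ⟨e⟩, -⟩ := h
  exact ⟨F (0 + 1), (LinearMap.range (d 0)).subtype ∘ₗ e, hF _,
    Subtype.val_injective.comp e.injective⟩

/-- If every finitely presented module embeds in a flat module, then every injective module is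
flat. -/
theorem flat_of_injective_of_finitePresentation_embeds {R : Type u} [CommRing R]
    (h : ∀ (P : Type u) [AddCommGroup P] [Module R P], Module.FinitePresentation R P →
      ∃ (F : ModuleCat.{u} R) (j : P →ₗ[R] F), Module.Flat R F ∧ Function.Injective j)
    (I : Type u) [AddCommGroup I] [Module R I] [Module.Injective R I] : Module.Flat R I := by
  refine Module.Flat.of_forall_exists_factorization fun {l f x} hx => ?_
  let K : Submodule R (Fin l →₀ R) := Submodule.span R {f}
  have hK : Module.FinitePresentation R ((Fin l →₀ R) ⧸ K) :=
    Module.finitePresentation_of_surjective K.mkQ K.mkQ_surjective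
      (by rw [Submodule.ker_mkQ]; exact Submodule.fg_span_singleton f)
  obtain ⟨F, j, hF, hj⟩ := h _ hK
  have hle : K ≤ LinearMap.ker x := by simpa [K, Submodule.span_le] using hx
  obtain ⟨g, hg⟩ := Module.Injective.out j hj (K.liftQ x hle)
  obtain ⟨k, a, b, hab⟩ := Module.Flat.exists_factorization_of_finitePresentation j
  refine ⟨k, a ∘ₗ K.mkQ, g ∘ₗ b, ?_, ?_⟩
  · refine LinearMap.ext fun v => ?_
    have := hg (K.mkQ v)
    rw [hab] at this
    exact this.symm
  · have : K.mkQ f = 0 := by simp [K, Submodule.mem_span_singleton_self]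
    simp only [LinearMap.comp_apply, this, map_zero]

/-- `R` is Gorenstein Von Neumann regular iff every finitely presented `R`-module is
Gorenstein flat. -/
theorem gorensteinVonNeumannRegular_iff_finitelyPresented_gorensteinFlat
    (R : Type u) [CommRing R] :
    (∀ (M : Type u) [AddCommGroup M] [Module R M], IsGorensteinFlat R M) ↔
    (∀ (M : Type u) [AddCommGroup M] [Module R M],
      Module.FinitePresentation R M → IsGorensteinFlat R M) := by
  refine ⟨fun h M _ _ _ => h M, fun h => isGorensteinFlat_of_flat_of_injective fun I _ => ?_⟩
  exact flat_of_injective_of_finitePresentation_embeds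
    (fun P _ _ hP => (h P hP).exists_injective_flat) I
end

section
/- A commutative ring R is Gorenstein Von Neumann regular (every R-module is Gorenstein flat) if and only if every finitely presented R-module is Gorenstein projective. -/
universe u

section Splicing

variable {R : Type u} [CommRing R]

/-- Linear maps `f : A → B` satisfying a predicate `good`. -/
structure GoodMap (good : ∀ {A B : ModuleCat.{u} R}, (A →ₗ[R] B) → Prop) where
  {A B : ModuleCat.{u} R}
  map : A →ₗ[R] B
  isGood : good map

/-- A good map `f` extends to an exact `ℤ`-indexed complex of good maps with `f` in degree `0`,
provided that every good map can be extended exactly by a good map on either side. -/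
theorem exists_int_exact_extension
    (good : ∀ {A B : ModuleCat.{u} R}, (A →ₗ[R] B) → Prop)
    (right : ∀ {A B : ModuleCat.{u} R} (f : A →ₗ[R] B), good f →
      ∃ (C : ModuleCat.{u} R) (g : B →ₗ[R] C), good g ∧ LinearMap.range f = LinearMap.ker g)
    (left : ∀ {A B : ModuleCat.{u} R} (f : A →ₗ[R] B), good f →
      ∃ (C : ModuleCat.{u} R) (g : C →ₗ[R] A), good g ∧ LinearMap.range g = LinearMap.ker f)
    {A B : ModuleCat.{u} R} (f : A →ₗ[R] B) (hf : good f) :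
    ∃ (P : ℤ → ModuleCat.{u} R) (d : ∀ i : ℤ, P i →ₗ[R] P (i + 1)),
      (∀ i, good (d i)) ∧ (∀ i, LinearMap.range (d i) = LinearMap.ker (d (i + 1))) ∧
      Nonempty (LinearMap.range f ≃ₗ[R] LinearMap.range (d 0)) := by
  choose rC rg rgood rexact using @right
  choose lC lg lgood lexact using @left
  let r : ℕ → GoodMap good := fun n ↦
    Nat.rec ⟨f, hf⟩ (fun _ a ↦ ⟨rg a.map a.isGood, rgood a.map a.isGood⟩) n
  let l : ℕ → GoodMap good := fun n ↦
    Nat.rec ⟨f, hf⟩ (fun _ a ↦ ⟨lg a.map a.isGood, lgood a.map a.isGood⟩) n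
  let P : ℤ → ModuleCat.{u} R := fun i ↦ match i with
    | .ofNat n => (r n).A
    | .negSucc n => (l (n + 1)).A
  let d : ∀ i : ℤ, P i →ₗ[R] P (i + 1) := fun i ↦ match i with
    | .ofNat n => (r n).map
    | .negSucc 0 => (l 1).map
    | .negSucc (n + 1) => (l (n + 2)).map
  refine ⟨P, d, fun i ↦ ?_, fun i ↦ ?_, ⟨LinearEquiv.refl R _⟩⟩
  · match i with
    | .ofNat n => exact (r n).isGood
    | .negSucc 0 => exact (l 1).isGood
    | .negSucc (n + 1) => exact (l (n + 2)).isGood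
  · match i with
    | .ofNat n => exact rexact (r n).map (r n).isGood
    | .negSucc 0 => exact lexact f hf
    | .negSucc 1 => exact lexact (l 1).map (l 1).isGood
    | .negSucc (n + 2) => exact lexact (l (n + 2)).map (l (n + 2)).isGood

end Splicing

section EmbeddingIntoFree

variable {R : Type u} [CommRing R]

/-- Every finitely presented `R`-module embeds into a finite free module. -/
def FinitelyPresentedEmbedsInFree (R : Type u) [CommRing R] : Prop :=
  ∀ (M : Type u) [AddCommGroup M] [Module R M], Module.FinitePresentation R M →
    ∃ (n : ℕ) (j : M →ₗ[R] (Fin n →₀ R)), Function.Injective j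

theorem finitelyPresentedEmbedsInFree_of_flat
    (h : ∀ (M : Type u) [AddCommGroup M] [Module R M], Module.FinitePresentation R M →
      ∃ (F : ModuleCat.{u} R) (j : M →ₗ[R] F), Module.Flat R F ∧ Function.Injective j) :
    FinitelyPresentedEmbedsInFree R := by
  intro M _ _ hM
  obtain ⟨F, j, _, hj⟩ := h M hM
  obtain ⟨k, a, y, rfl⟩ := Module.Flat.exists_factorization_of_finitePresentation j
  exact ⟨k, a, Function.Injective.of_comp (f := y) (by simpa using hj)⟩

namespace FinitelyPresentedEmbedsInFree

/-- A map between finite modules, the target being projective, extends to the right by a map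
to a finite free module. -/
theorem exists_range_eq_ker (h : FinitelyPresentedEmbedsInFree R) {A B : Type u}
    [AddCommGroup A] [Module R A] [AddCommGroup B] [Module R B] [Module.Finite R A]
    [Module.Finite R B] [Module.Projective R B] (f : A →ₗ[R] B) :
    ∃ (n : ℕ) (g : B →ₗ[R] (Fin n →₀ R)), LinearMap.range f = LinearMap.ker g := by
  have : Module.FinitePresentation R B := Module.finitePresentation_of_projective R B
  have : Module.FinitePresentation R (B ⧸ LinearMap.range f) :=
    Module.finitePresentation_of_surjective (LinearMap.range f).mkQ
      (Submodule.mkQ_surjective _) (by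
        rw [Submodule.ker_mkQ, LinearMap.range_eq_map]
        exact Module.Finite.fg_top.map f)
  obtain ⟨n, j, hj⟩ := h (B ⧸ LinearMap.range f) this
  refine ⟨n, j ∘ₗ (LinearMap.range f).mkQ, ?_⟩
  rw [LinearMap.ker_comp_of_ker_eq_bot _ (LinearMap.ker_eq_bot.mpr hj), Submodule.ker_mkQ]

/-- Functionals vanishing on the kernel of a map of finite projective modules factor through
that map. -/
theorem exists_dual_eq_comp (h : FinitelyPresentedEmbedsInFree R) {A B : Type u}
    [AddCommGroup A] [Module R A] [AddCommGroup B] [Module R B] [Module.Finite R A]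
    [Module.Projective R A] [Module.Finite R B] [Module.Projective R B] (f : A →ₗ[R] B)
    (v : Module.Dual R A) (hv : LinearMap.ker f ≤ LinearMap.ker v) :
    ∃ w : Module.Dual R B, v = w ∘ₗ f := by
  obtain ⟨n, g, hg⟩ := h.exists_range_eq_ker f.dualMap
  suffices v ∈ LinearMap.range f.dualMap from this.imp fun _ hw ↦ hw.symm
  rw [hg, LinearMap.mem_ker, ← Module.forall_dual_apply_eq_zero_iff R]
  intro φ
  set a := (Module.evalEquiv R A).symm (φ ∘ₗ g)
  have key (w : Module.Dual R A) : w a = φ (g w) := by simp [a]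
  rw [← key]
  refine hv ?_
  rw [LinearMap.mem_ker, ← Module.forall_dual_apply_eq_zero_iff R]
  intro w
  have hw : g (f.dualMap w) = 0 := by
    rw [← LinearMap.mem_ker, ← hg]
    exact LinearMap.mem_range_self _ w
  rw [← LinearMap.dualMap_apply, key, hw, map_zero]

/-- A map of finite projective modules extends to the left by a map from a finite projective
module. -/
theorem exists_left_range_eq_ker (h : FinitelyPresentedEmbedsInFree R) {A B : Type u}
    [AddCommGroup A] [Module R A] [AddCommGroup B] [Module R B] [Module.Finite R A]
    [Module.Projective R A] [Module.Finite R B] [Module.Projective R B] (f : A →ₗ[R] B) :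
    ∃ (n : ℕ) (g : Module.Dual R (Fin n →₀ R) →ₗ[R] A),
      LinearMap.range g = LinearMap.ker f := by
  obtain ⟨n, g, hg⟩ := h.exists_range_eq_ker f.dualMap
  refine ⟨n, (Module.evalEquiv R A).symm.toLinearMap ∘ₗ g.dualMap, le_antisymm ?_ fun a ha ↦ ?_⟩
  · rintro _ ⟨φ, rfl⟩
    rw [LinearMap.mem_ker, ← Module.forall_dual_apply_eq_zero_iff R]
    intro w
    have hw : g (f.dualMap w) = 0 := by
      rw [← LinearMap.mem_ker, ← hg]
      exact LinearMap.mem_range_self _ w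
    rw [← LinearMap.dualMap_apply]
    have hφ : (g.dualMap φ) (f.dualMap w) = 0 := by rw [LinearMap.dualMap_apply, hw, map_zero]
    simpa [-LinearMap.dualMap_apply] using hφ
  · obtain ⟨φ, hφ⟩ := h.exists_dual_eq_comp g (Module.Dual.eval R A a) (by
      rw [← hg]
      rintro _ ⟨w, rfl⟩
      rw [LinearMap.mem_ker] at ha
      simp [ha])
    refine ⟨φ, ?_⟩
    rw [LinearMap.comp_apply, LinearEquiv.coe_coe, LinearEquiv.symm_apply_eq,
      Module.evalEquiv_apply, hφ]
    rfl

/-- Maps to a projective module vanishing on the kernel of a map of finite projective modules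
factor through that map. -/
theorem exists_eq_comp (h : FinitelyPresentedEmbedsInFree R) {A B Q : Type u}
    [AddCommGroup A] [Module R A] [AddCommGroup B] [Module R B] [AddCommGroup Q] [Module R Q]
    [Module.Finite R A] [Module.Projective R A] [Module.Finite R B] [Module.Projective R B]
    [Module.Projective R Q] (f : A →ₗ[R] B) (v : A →ₗ[R] Q)
    (hv : LinearMap.ker f ≤ LinearMap.ker v) :
    ∃ w : B →ₗ[R] Q, v = w ∘ₗ f := by
  classical
  obtain ⟨s, hs⟩ := Module.projective_lifting_property
    (Finsupp.linearCombination R (id : Q → Q)) LinearMap.id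
    (Finsupp.linearCombination_id_surjective R Q)
  obtain ⟨t, ht⟩ := (inferInstance : Module.Finite R A).fg_top
  choose w hw using fun q : Q ↦ h.exists_dual_eq_comp f (Finsupp.lapply q ∘ₗ s ∘ₗ v)
    (fun a ha ↦ by simp [LinearMap.mem_ker.mp (hv ha)])
  let S : Finset Q := t.biUnion fun a ↦ (s (v a)).support
  refine ⟨Finsupp.linearCombination R id ∘ₗ ∑ q ∈ S, Finsupp.lsingle q ∘ₗ w q, ?_⟩
  refine LinearMap.ext_on ht fun a ha ↦ ?_
  have hsum : ∑ q ∈ S, Finsupp.single q (w q (f a)) = s (v a) := by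
    have hwa (q : Q) : w q (f a) = s (v a) q := by
      simpa using (LinearMap.congr_fun (hw q) a).symm
    simp_rw [hwa]
    exact (Finsupp.sum_of_support_subset (s (v a))
      (Finset.subset_biUnion_of_mem (fun a ↦ (s (v a)).support) ha) _ (by simp)).symm.trans
      (Finsupp.sum_single _)
  have := LinearMap.congr_fun hs (v a)
  simp only [LinearMap.comp_apply, LinearMap.sum_apply, Finsupp.lsingle_apply, hsum]
  exact this.symm

/-- Injective modules are flat. -/
theorem flat_of_injective (h : FinitelyPresentedEmbedsInFree R) (I : Type u) [AddCommGroup I]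
    [Module R I] [Module.Injective R I] : Module.Flat R I := by
  refine Module.Flat.of_forall_exists_factorization fun {l f x} hx ↦ ?_
  obtain ⟨n, g, hg⟩ := h.exists_range_eq_ker (LinearMap.toSpanSingleton R _ f)
  have hfg : LinearMap.ker g ≤ LinearMap.ker x := by
    rw [← hg]
    rintro _ ⟨r, rfl⟩
    simp [hx]
  obtain ⟨y, hy⟩ := Module.Injective.out ((LinearMap.ker g).liftQ g le_rfl)
    (LinearMap.ker_eq_bot.mp (Submodule.ker_liftQ_eq_bot _ _ _ le_rfl))
    ((LinearMap.ker g).liftQ x hfg)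
  refine ⟨n, g, y, ?_, ?_⟩
  · ext1 a
    ext1
    simpa using (hy (Submodule.Quotient.mk (Finsupp.single a 1))).symm
  · rw [← LinearMap.mem_ker, ← hg]
    exact ⟨1, by simp⟩

theorem isGorensteinProjective (h : FinitelyPresentedEmbedsInFree R) (M : Type u)
    [AddCommGroup M] [Module R M] (hM : Module.FinitePresentation R M) :
    IsGorensteinProjective R M := by
  obtain ⟨n, j, hj⟩ := h M hM
  obtain ⟨m, p, hp⟩ := Module.Finite.exists_fin' R M
  obtain ⟨P, d, hgood, hexact, ⟨e⟩⟩ := exists_int_exact_extension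
    (fun {A B : ModuleCat.{u} R} _ ↦ (Module.Finite R A ∧ Module.Projective R A) ∧
      (Module.Finite R B ∧ Module.Projective R B))
    (fun {A B} f ⟨⟨_, _⟩, ⟨hB, hB'⟩⟩ ↦
      have ⟨k, g, hg⟩ := h.exists_range_eq_ker f
      ⟨ModuleCat.of R (Fin k →₀ R), g, ⟨⟨hB, hB'⟩, inferInstanceAs (Module.Finite R (Fin k →₀ R)),
        inferInstanceAs (Module.Projective R (Fin k →₀ R))⟩, hg⟩)
    (fun {A B} f ⟨⟨hA, hA'⟩, ⟨_, _⟩⟩ ↦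
      have ⟨k, g, hg⟩ := h.exists_left_range_eq_ker f
      ⟨ModuleCat.of R (Module.Dual R (Fin k →₀ R)), g,
        ⟨⟨inferInstanceAs (Module.Finite R (Module.Dual R (Fin k →₀ R))),
          inferInstanceAs (Module.Projective R (Module.Dual R (Fin k →₀ R)))⟩, hA, hA'⟩, hg⟩)
    (A := ModuleCat.of R (Fin m → R)) (B := ModuleCat.of R (Fin n →₀ R)) (j ∘ₗ p)
    ⟨⟨inferInstanceAs (Module.Finite R (Fin m → R)),
      inferInstanceAs (Module.Projective R (Fin m → R))⟩,
      inferInstanceAs (Module.Finite R (Fin n →₀ R)),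
      inferInstanceAs (Module.Projective R (Fin n →₀ R))⟩
  refine ⟨P, d, fun i ↦ (hgood i).1.2, hexact, ⟨?_⟩, fun Q _ i f hf ↦ ?_⟩
  · have hr : LinearMap.range j = LinearMap.range (j ∘ₗ p) :=
      (LinearMap.range_comp_of_range_eq_top j (LinearMap.range_eq_top.mpr hp)).symm
    exact LinearEquiv.ofInjective j hj ≪≫ₗ LinearEquiv.ofEq _ _ hr ≪≫ₗ e
  · obtain ⟨⟨_, _⟩, _, _⟩ := hgood (i + 1)
    refine h.exists_eq_comp (d (i + 1)) f ?_
    rw [← hexact i]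
    exact LinearMap.range_le_ker_iff.mpr hf

theorem isGorensteinFlat (h : FinitelyPresentedEmbedsInFree R) (M : Type u)
    [AddCommGroup M] [Module R M] : IsGorensteinFlat R M := by
  have embed (N : Type u) [AddCommGroup N] [Module R N] :
      ∃ (E : ModuleCat.{u} R) (j : N →ₗ[R] E), Module.Flat R E ∧ Function.Injective j := by
    let ι := CategoryTheory.Injective.ι (ModuleCat.of R N)
    have : Module.Injective R (CategoryTheory.Injective.under (ModuleCat.of R N) :) :=
      (Module.injective_iff_injective_object R _).mpr
        (CategoryTheory.Injective.injective_under (ModuleCat.of R N))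
    exact ⟨_, ι.hom, h.flat_of_injective _, (ModuleCat.mono_iff_injective ι).mp inferInstance⟩
  obtain ⟨E, j, hE, hj⟩ := embed M
  obtain ⟨P, d, hgood, hexact, ⟨e⟩⟩ := exists_int_exact_extension
    (fun {A B : ModuleCat.{u} R} _ ↦ Module.Flat R A ∧ Module.Flat R B)
    (fun {A B} f ⟨_, hB⟩ ↦ by
      obtain ⟨C, g, hC, hg⟩ := embed (B ⧸ LinearMap.range f)
      refine ⟨C, g ∘ₗ (LinearMap.range f).mkQ, ⟨hB, hC⟩, ?_⟩
      rw [LinearMap.ker_comp_of_ker_eq_bot _ (LinearMap.ker_eq_bot.mpr hg), Submodule.ker_mkQ])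
    (fun {A B} f ⟨hA, _⟩ ↦ by
      refine ⟨ModuleCat.of R (LinearMap.ker f →₀ R), Finsupp.linearCombination R Subtype.val,
        ⟨inferInstanceAs (Module.Flat R (LinearMap.ker f →₀ R)), hA⟩, ?_⟩
      exact (Finsupp.range_linearCombination R).trans (by
        rw [Subtype.range_coe_subtype]
        exact Submodule.span_eq (LinearMap.ker f)))
    (A := ModuleCat.of R (M →₀ R)) (B := E) (j ∘ₗ Finsupp.linearCombination R id)
    ⟨inferInstanceAs (Module.Flat R (M →₀ R)), hE⟩
  refine ⟨P, d, fun i ↦ (hgood i).1, hexact, ⟨?_⟩, fun I _ i ↦ ?_⟩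
  · have hr : LinearMap.range j = LinearMap.range (j ∘ₗ Finsupp.linearCombination R id) :=
      (LinearMap.range_comp_of_range_eq_top j (LinearMap.range_eq_top.mpr
        (Finsupp.linearCombination_id_surjective R M))).symm
    exact LinearEquiv.ofInjective j hj ≪≫ₗ LinearEquiv.ofEq _ _ hr ≪≫ₗ e
  · have := h.flat_of_injective I
    exact (Module.Flat.lTensor_exact I
      (LinearMap.exact_iff.mpr (hexact i).symm)).linearMap_ker_eq.symm

end FinitelyPresentedEmbedsInFree

end EmbeddingIntoFree

/-- `R` is Gorenstein Von Neumann regular iff every finitely presented `R`-module is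
Gorenstein projective. -/
theorem gorensteinVonNeumannRegular_iff_finitelyPresented_gorensteinProjective
    (R : Type u) [CommRing R] :
    (∀ (M : Type u) [AddCommGroup M] [Module R M], IsGorensteinFlat R M) ↔
    (∀ (M : Type u) [AddCommGroup M] [Module R M],
      Module.FinitePresentation R M → IsGorensteinProjective R M) := by
  refine ⟨fun h ↦ FinitelyPresentedEmbedsInFree.isGorensteinProjective
    (finitelyPresentedEmbedsInFree_of_flat fun M _ _ _ ↦ ?_), fun h M _ _ ↦
    FinitelyPresentedEmbedsInFree.isGorensteinFlat
    (finitelyPresentedEmbedsInFree_of_flat fun M _ _ hM ↦ ?_) M⟩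
  · obtain ⟨F, d, hF, -, ⟨e⟩, -⟩ := h M
    exact ⟨_, (LinearMap.range (d 0)).subtype ∘ₗ e.toLinearMap, hF (0 + 1),
      (Submodule.injective_subtype _).comp e.injective⟩
  · obtain ⟨P, d, hP, -, ⟨e⟩, -⟩ := h M hM
    have := hP (0 + 1)
    exact ⟨_, (LinearMap.range (d 0)).subtype ∘ₗ e.toLinearMap, inferInstance,
      (Submodule.injective_subtype _).comp e.injective⟩
end

section
/- Every Gorenstein Von Neumann regular commutative ring is coherent; that is, if every module over a commutative ring R is Gorenstein flat, then every finitely generated ideal of R is finitely presented. -/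
universe u

open Matrix in
/-- If every module embeds in a flat module, then every finitely generated submodule of a finite
free module is the kernel of a matrix. -/
theorem exists_matrix_mem_iff_mulVec_eq_zero {R : Type u} [CommRing R]
    (h : ∀ (M : Type u) [AddCommGroup M] [Module R M], ∃ (F : ModuleCat.{u} R) (f : M →ₗ[R] F),
      Module.Flat R F ∧ Function.Injective f)
    {n : ℕ} (P : Submodule R (Fin n → R)) (hP : P.FG) :
    ∃ (k : ℕ) (A : Matrix (Fin k) (Fin n) R), ∀ y, y ∈ P ↔ A *ᵥ y = 0 := by
  obtain ⟨F, f, hF, hf⟩ := h ((Fin n → R) ⧸ P)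
  have : Module.FinitePresentation R ((Fin n → R) ⧸ P) :=
    Module.finitePresentation_of_surjective P.mkQ P.mkQ_surjective (by rwa [P.ker_mkQ])
  obtain ⟨k, g, g', rfl⟩ := Module.Flat.exists_factorization_of_finitePresentation f
  have hg : Function.Injective g := Function.Injective.of_comp (f := g') (by simpa using hf)
  refine ⟨k, LinearMap.toMatrix'
    ((Finsupp.linearEquivFunOnFinite R R (Fin k)).toLinearMap ∘ₗ g ∘ₗ P.mkQ), fun y ↦ ?_⟩
  rw [← Matrix.toLin'_apply, Matrix.toLin'_toMatrix']
  simp [map_eq_zero_iff g hg]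

open Matrix in
/-- If every module over `R` embeds in a flat module, then `R` is coherent. -/
theorem isCoherentRing_of_forall_embeds_flat {R : Type u} [CommRing R]
    (h : ∀ (M : Type u) [AddCommGroup M] [Module R M], ∃ (F : ModuleCat.{u} R) (f : M →ₗ[R] F),
      Module.Flat R F ∧ Function.Injective f) :
    IsCoherentRing R := by
  intro I hI
  obtain ⟨n, a, rfl⟩ := Submodule.fg_iff_exists_fin_generating_family.mp hI
  set φ : (Fin n → R) →ₗ[R] R := Fintype.linearCombination R a with hφ
  have φ_apply (y : Fin n → R) : φ y = y ⬝ᵥ a := by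
    simp [hφ, Fintype.linearCombination_apply, dotProduct]
  have hker : (LinearMap.ker φ).FG := by
    obtain ⟨k, B, hB⟩ := exists_matrix_mem_iff_mulVec_eq_zero h _ (Submodule.fg_span_singleton a)
    have hQ : (Submodule.span R (Set.range B)).FG := Submodule.fg_span (Set.finite_range B)
    obtain ⟨l, C, hC⟩ := exists_matrix_mem_iff_mulVec_eq_zero h _ hQ
    convert hQ
    apply le_antisymm
    · intro y hy
      rw [LinearMap.mem_ker, φ_apply] at hy
      rw [hC]
      funext j
      have hw : C j ∈ Submodule.span R {a} := by
        rw [hB]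
        funext m
        have := congrFun ((hC (B m)).mp (Submodule.subset_span ⟨m, rfl⟩)) j
        rwa [mulVec, dotProduct_comm] at this
      obtain ⟨r, hr⟩ := Submodule.mem_span_singleton.mp hw
      change C j ⬝ᵥ y = 0
      rw [← hr, smul_dotProduct, dotProduct_comm, hy, smul_zero]
    · rw [Submodule.span_le]
      rintro _ ⟨m, rfl⟩
      rw [SetLike.mem_coe, LinearMap.mem_ker, φ_apply]
      exact congrFun ((hB a).mp (Submodule.mem_span_singleton_self a)) m
  rw [← Fintype.range_linearCombination R a]
  exact Module.finitePresentation_of_surjective φ.rangeRestrict φ.surjective_rangeRestrict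
    (by rwa [φ.ker_rangeRestrict])

/-- Every Gorenstein Von Neumann regular commutative ring is coherent. -/
theorem gorensteinVonNeumannRegular_is_coherent (R : Type u) [CommRing R]
    (h : ∀ (M : Type u) [AddCommGroup M] [Module R M], IsGorensteinFlat R M) :
    IsCoherentRing R := by
  refine isCoherentRing_of_forall_embeds_flat fun M _ _ ↦ ?_
  obtain ⟨F, d, hF, -, ⟨e⟩, -⟩ := h M
  exact ⟨F (0 + 1), (LinearMap.range (d 0)).subtype ∘ₗ e.toLinearMap, hF _,
    Subtype.val_injective.comp e.injective⟩
end

section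
/- Let R be a coherent commutative ring. Then every injective R-module is flat if and only if every FP-injective R-module is flat. -/
universe u

/-- An `R`-module `M` is **FP-injective** if `Ext¹_R(P, M) = 0` for every finitely
presented `R`-module `P`; equivalently, every short exact sequence `0 → M → E → P → 0`
with `P` finitely presented splits. -/
def IsFPInjective (R : Type u) [CommRing R] (M : Type u)
    [AddCommGroup M] [Module R M] : Prop :=
  ∀ P : ModuleCat.{u} R, Module.FinitePresentation R P →
    ∀ (E : ModuleCat.{u} R) (i : M →ₗ[R] E) (p : E →ₗ[R] P),
      Function.Injective i → Function.Surjective p →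
      LinearMap.range i = LinearMap.ker p →
      ∃ r : E →ₗ[R] M, r.comp i = LinearMap.id

section

variable {R : Type u} [CommRing R]

/-- Every embedding of an FP-injective module is pure: an extension problem along a map
from a finite module to a finitely presented one can be solved in `M` once it is solvable in an
overmodule of `M`. -/
theorem IsFPInjective.exists_comp_eq {M E F G : Type u}
    [AddCommGroup M] [Module R M] [AddCommGroup E] [Module R E]
    [AddCommGroup F] [Module R F] [AddCommGroup G] [Module R G]
    [Module.Finite R F] [Module.FinitePresentation R G] (hM : IsFPInjective R M)
    {i : M →ₗ[R] E} (hi : Function.Injective i) (φ : F →ₗ[R] G) (x : F →ₗ[R] M)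
    (y : G →ₗ[R] E) (h : i ∘ₗ x = y ∘ₗ φ) : ∃ z : G →ₗ[R] M, x = z ∘ₗ φ := by
  have hle : LinearMap.range φ ≤ (LinearMap.range i).comap y := by
    rintro _ ⟨f, rfl⟩
    exact ⟨x f, LinearMap.congr_fun h f⟩
  let ybar : G ⧸ LinearMap.range φ →ₗ[R] E ⧸ LinearMap.range i :=
    (LinearMap.range φ).mapQ (LinearMap.range i) y hle
  let S : Submodule R (E × (G ⧸ LinearMap.range φ)) :=
    LinearMap.eqLocus ((LinearMap.range i).mkQ ∘ₗ LinearMap.fst R _ _)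
      (ybar ∘ₗ LinearMap.snd R _ _)
  have hP : Module.FinitePresentation R (G ⧸ LinearMap.range φ) :=
    Module.finitePresentation_of_surjective (LinearMap.range φ).mkQ (Submodule.mkQ_surjective _)
      (by rw [Submodule.ker_mkQ]; exact Submodule.fg_range φ)
  let j : M →ₗ[R] S := (LinearMap.inl R _ _ ∘ₗ i).codRestrict S fun m ↦ by
    simp [S, LinearMap.mem_eqLocus]
  let p : S →ₗ[R] G ⧸ LinearMap.range φ := LinearMap.snd R _ _ ∘ₗ S.subtype
  let s : G →ₗ[R] S := (y.prod (LinearMap.range φ).mkQ).codRestrict S fun g ↦ by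
    simp [S, ybar, LinearMap.mem_eqLocus]
  have hj : Function.Injective j := fun a b hab ↦
    hi (congrArg (fun t : S ↦ t.1.1) hab)
  have hp : Function.Surjective p := fun q ↦ by
    obtain ⟨g, rfl⟩ := Submodule.mkQ_surjective _ q
    exact ⟨s g, rfl⟩
  have hjp : LinearMap.range j = LinearMap.ker p := by
    ext ⟨⟨e, q⟩, ht⟩
    constructor
    · rintro ⟨m, hm⟩
      rw [← hm]
      rfl
    · intro hq
      obtain rfl : q = 0 := hq
      have he : e ∈ LinearMap.range i := by
        simpa [S, LinearMap.mem_eqLocus] using ht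
      obtain ⟨m, rfl⟩ := he
      exact ⟨m, rfl⟩
  obtain ⟨r, hr⟩ := hM (ModuleCat.of R (G ⧸ LinearMap.range φ)) hP (ModuleCat.of R S) j p hj hp hjp
  refine ⟨r ∘ₗ s, LinearMap.ext fun f ↦ ?_⟩
  have hs : s (φ f) = j (x f) := by
    refine Subtype.ext (Prod.ext (LinearMap.congr_fun h f).symm ?_)
    exact (Submodule.Quotient.mk_eq_zero _).2 ⟨f, rfl⟩
  calc x f = r (j (x f)) := (LinearMap.congr_fun hr (x f)).symm
    _ = r (s (φ f)) := by rw [hs]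

/-- An FP-injective submodule of a flat module is flat. -/
theorem IsFPInjective.flat_of_injective {M E : Type u} [AddCommGroup M] [Module R M]
    [AddCommGroup E] [Module R E] [Module.Flat R E] (hM : IsFPInjective R M)
    {i : M →ₗ[R] E} (hi : Function.Injective i) : Module.Flat R M := by
  refine Module.Flat.iff_forall_exists_factorization.2 fun {l f x} hx ↦ ?_
  obtain ⟨k, a, y, hy, ha⟩ := Module.Flat.iff_forall_exists_factorization.1 ‹_›
    (f := f) (x := i ∘ₗ x) (by simp [hx])
  obtain ⟨z, hz⟩ := hM.exists_comp_eq hi a x y hy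
  exact ⟨k, a, z, hz, ha⟩

theorem Module.Injective.isFPInjective {M : Type u} [AddCommGroup M] [Module R M]
    (hM : Module.Injective R M) : IsFPInjective R M := by
  intro P _ E i p hi _ _
  obtain ⟨r, hr⟩ := hM.out i hi LinearMap.id
  exact ⟨r, LinearMap.ext hr⟩

variable (R) in
theorem Module.exists_injective_linearMap_to_injective (M : Type u) [AddCommGroup M]
    [Module R M] : ∃ (E : ModuleCat.{u} R) (i : M →ₗ[R] E),
      Module.Injective R E ∧ Function.Injective i := by
  obtain ⟨J⟩ := CategoryTheory.EnoughInjectives.presentation (ModuleCat.of R M)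
  exact ⟨J.J, J.f.hom, (Module.injective_iff_injective_object R J.J).2 J.injective,
    (ModuleCat.mono_iff_injective J.f).1 J.mono⟩

end

/-- For a coherent commutative ring `R`, every injective `R`-module is flat iff every
FP-injective `R`-module is flat. -/
theorem coherent_injective_flat_iff_fpInjective_flat (R : Type u) [CommRing R]
    (hcoh : IsCoherentRing R) :
    (∀ (I : Type u) [AddCommGroup I] [Module R I],
      Module.Injective R I → Module.Flat R I) ↔
    (∀ (M : Type u) [AddCommGroup M] [Module R M],
      IsFPInjective R M → Module.Flat R M) := by
  refine ⟨fun h M _ _ hM ↦ ?_, fun h I _ _ hI ↦ h I hI.isFPInjective⟩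
  obtain ⟨E, i, hE, hi⟩ := Module.exists_injective_linearMap_to_injective R M
  have := h E hE
  exact hM.flat_of_injective hi
end
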